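/- arXiv:math/0305327 — 6 statements merged into one kernel-verified Lean document; each statement's English description precedes it below -/
import Mathlib

section
/- For all n ≥ 1, the following polynomial identity holds in ℤ[q,t]: the sum over all 321-avoiding permutations π of {1,…,n} of q^{2·lis(π)+1} t^{2·ldes(π)} equals the sum over all π ∈ T*_{2n} of sign(π)·q^{lis(π)} t^{ldes(π)} plus q times the sum over all π ∈ T⋆_{2n} of sign(π)·q^{lis(π)} t^{ldes(π)}, where T*_{2n} (resp. T⋆_{2n}) is the set of 321-avoiding permutations of {1,…,2n} whose last descent is even and whose longest increasing subsequence has odd (resp. even) length. -/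
open scoped Classical
open MvPolynomial

/-- A permutation of `{1,…,n}` (modeled on `Fin n`) is 321-avoiding if there are no
indices `i < j < k` with `π i > π j > π k`. -/
def Avoids321 {n : ℕ} (π : Equiv.Perm (Fin n)) : Prop :=
  ¬ ∃ i j k : Fin n, i < j ∧ j < k ∧ π k < π j ∧ π j < π i

/-- The length of the longest increasing subsequence of a permutation. -/
noncomputable def lis {n : ℕ} (π : Equiv.Perm (Fin n)) : ℕ :=
  sSup {k : ℕ | ∃ s : Finset (Fin n),
    (∀ i ∈ s, ∀ j ∈ s, i < j → π i < π j) ∧ s.card = k}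

/-- The last (largest) descent of a permutation, in 1-based positions:
the largest `d` with `π(d) > π(d+1)`, and `0` for the identity (no descent). -/
noncomputable def ldes {n : ℕ} (π : Equiv.Perm (Fin n)) : ℕ :=
  sSup {d : ℕ | 1 ≤ d ∧ ∃ h : d < n, π ⟨d, h⟩ < π ⟨d - 1, by omega⟩}

namespace SignBalance

/-- The permutation of `Fin (m + 1)` obtained from `π` by inserting the new largest value
at position `i`. -/
def insertMax {m : ℕ} (i : Fin (m + 1)) (π : Equiv.Perm (Fin m)) : Equiv.Perm (Fin (m + 1)) :=
  (Fin.cycleRange (Fin.last m))⁻¹ * Equiv.Perm.decomposeFin.symm (0, π) * Fin.cycleRange i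

section insertMax

variable {m : ℕ}

@[simp]
lemma insertMax_self (i : Fin (m + 1)) (π : Equiv.Perm (Fin m)) :
    insertMax i π i = Fin.last m := by
  simp [insertMax, -Fin.cycleRange_last]

@[simp]
lemma insertMax_succAbove (i : Fin (m + 1)) (π : Equiv.Perm (Fin m)) (x : Fin m) :
    insertMax i π (i.succAbove x) = (π x).castSucc := by
  rw [insertMax, Equiv.Perm.mul_apply, Equiv.Perm.mul_apply, Fin.cycleRange_succAbove,
    Equiv.Perm.decomposeFin_symm_apply_succ, Equiv.swap_self, Equiv.refl_apply,
    Equiv.Perm.inv_eq_iff_eq, ← Fin.succAbove_last_apply, Fin.cycleRange_succAbove]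

lemma sign_insertMax (i : Fin (m + 1)) (π : Equiv.Perm (Fin m)) :
    Equiv.Perm.sign (insertMax i π) = (-1) ^ (m - i : ℕ) * Equiv.Perm.sign π := by
  have h : m = (m - i : ℕ) + i := by omega
  have h2 : ((-1 : ℤˣ) ^ (i : ℕ)) * (-1) ^ (i : ℕ) = 1 := by rw [← mul_pow]; simp
  rw [insertMax, map_mul, map_mul, Equiv.Perm.sign_inv, Fin.sign_cycleRange, Fin.sign_cycleRange,
    Equiv.Perm.decomposeFin.symm_sign, if_pos rfl, one_mul, Fin.val_last]
  nth_rw 1 [h]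
  rw [pow_add, mul_right_comm, mul_assoc _ _ ((-1 : ℤˣ) ^ (i : ℕ)), h2, mul_one]

lemma insertMax_bijective :
    Function.Bijective
      (fun p : Fin (m + 1) × Equiv.Perm (Fin m) => insertMax p.1 p.2) := by
  rw [Fintype.bijective_iff_injective_and_card]
  refine ⟨?_, by simp [Fintype.card_perm, Nat.factorial_succ]⟩
  rintro ⟨i, π⟩ ⟨j, σ⟩ h
  have h' : insertMax i π = insertMax j σ := h
  have hij : i = j := by
    apply (insertMax j σ).injective
    rw [← h', insertMax_self, h', insertMax_self]
  subst hij
  congr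
  ext x
  have := congrArg (fun τ => (τ (i.succAbove x) : ℕ)) h'
  simpa using this

/-- The entries of `π` from position `d` on are increasing. -/
def IncFrom (π : Equiv.Perm (Fin m)) (d : ℕ) : Prop :=
  ∀ x y : Fin m, d ≤ x → x < y → π x < π y

lemma ldes_le_iff (π : Equiv.Perm (Fin m)) (d : ℕ) : ldes π ≤ d ↔ IncFrom π d := by
  have hb : BddAbove {d : ℕ | 1 ≤ d ∧ ∃ h : d < m, π ⟨d, h⟩ < π ⟨d - 1, by omega⟩} :=
    ⟨m, fun x hx => hx.2.1.le⟩
  constructor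
  · intro h x y hx hxy
    have key : ∀ k : ℕ, ∀ hk : (x : ℕ) + k + 1 < m, π x < π ⟨x + k + 1, hk⟩ := by
      have step : ∀ a : ℕ, ∀ ha : a + 1 < m, d ≤ a → π ⟨a, by omega⟩ < π ⟨a + 1, ha⟩ := by
        intro a ha hda
        by_contra hcon
        have hne : π ⟨a, by omega⟩ ≠ π ⟨a + 1, ha⟩ := by
          intro he
          have := π.injective he
          simp at this
        have : a + 1 ≤ ldes π := le_csSup hb
          ⟨by omega, ha, lt_of_le_of_ne (not_lt.mp hcon) hne.symm⟩
        omega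
      intro k
      induction k with
      | zero => intro hk; exact step x hk hx
      | succ k ih =>
        intro hk
        exact (ih (by omega)).trans (step (x + k + 1) hk (by omega))
    have hxy' : (x : ℕ) < y := hxy
    have := key (y - x - 1) (by omega)
    convert this using 3
    omega
  · intro h
    by_cases hne : {d : ℕ | 1 ≤ d ∧ ∃ h : d < m, π ⟨d, h⟩ < π ⟨d - 1, by omega⟩}.Nonempty
    · refine csSup_le hne ?_
      rintro b ⟨hb1, hbm, hlt⟩
      by_contra hcon
      refine absurd hlt (not_lt.mpr (h ⟨b - 1, by omega⟩ ⟨b, hbm⟩ ?_ ?_).le)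
      · simp only; omega
      · rw [Fin.mk_lt_mk]; omega
    · rw [Set.not_nonempty_iff_eq_empty] at hne
      rw [ldes, hne]
      simp

lemma ldes_le (π : Equiv.Perm (Fin m)) : ldes π ≤ m := by
  rw [ldes_le_iff]
  intro x y hx
  omega

lemma ldes_lt (π : Equiv.Perm (Fin (m + 1))) : ldes π ≤ m := by
  rw [ldes_le_iff]
  intro x y hx hxy
  have : (x : ℕ) < y := hxy
  omega

lemma incFrom_insertMax_last (π : Equiv.Perm (Fin m)) (d : ℕ) :
    IncFrom (insertMax (Fin.last m) π) d ↔ IncFrom π d := by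
  constructor
  · intro h x y hx hxy
    have := h ((Fin.last m).succAbove x) ((Fin.last m).succAbove y) (by simpa using hx)
      (by simpa using hxy)
    simpa only [insertMax_succAbove, Fin.castSucc_lt_castSucc_iff] using this
  · intro h x y hx hxy
    rcases Fin.eq_self_or_eq_succAbove (Fin.last m) x with rfl | ⟨x, rfl⟩
    · exact absurd hxy (not_lt.mpr (Fin.le_last y))
    rcases Fin.eq_self_or_eq_succAbove (Fin.last m) y with rfl | ⟨y, rfl⟩
    · rw [insertMax_succAbove, insertMax_self]; exact Fin.castSucc_lt_last _
    rw [insertMax_succAbove, insertMax_succAbove, Fin.castSucc_lt_castSucc_iff]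
    exact h x y (by simpa using hx) (by simpa using hxy)

lemma ldes_insertMax_last (π : Equiv.Perm (Fin m)) :
    ldes (insertMax (Fin.last m) π) = ldes π :=
  eq_of_forall_ge_iff fun d => by rw [ldes_le_iff, ldes_le_iff, incFrom_insertMax_last]

lemma val_succAbove_of_le (i : Fin (m + 1)) (x : Fin m) (h : (i : ℕ) ≤ x) :
    (i.succAbove x : ℕ) = x + 1 := by
  rw [Fin.succAbove_of_le_castSucc _ _ (by simpa [Fin.le_def] using h), Fin.val_succ]

lemma val_succAbove_of_lt (i : Fin (m + 1)) (x : Fin m) (h : (x : ℕ) < i) :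
    (i.succAbove x : ℕ) = x := by
  rw [Fin.succAbove_of_castSucc_lt _ _ (by simpa [Fin.lt_def] using h), Fin.val_castSucc]

lemma ldes_insertMax_castSucc (π : Equiv.Perm (Fin m)) (i : Fin m) (hi : ldes π ≤ i) :
    ldes (insertMax i.castSucc π) = i + 1 := by
  rw [ldes_le_iff] at hi
  apply le_antisymm
  · rw [ldes_le_iff]
    intro x y hx hxy
    have hxy' : (x : ℕ) < y := hxy
    rcases Fin.eq_self_or_eq_succAbove i.castSucc x with rfl | ⟨x, rfl⟩
    · simp at hx
    rcases Fin.eq_self_or_eq_succAbove i.castSucc y with rfl | ⟨y, rfl⟩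
    · rw [Fin.val_castSucc] at hxy'; omega
    rw [insertMax_succAbove, insertMax_succAbove, Fin.castSucc_lt_castSucc_iff]
    rw [Fin.succAbove_lt_succAbove_iff] at hxy
    refine hi x y ?_ hxy
    by_contra hcon
    rw [val_succAbove_of_lt _ _ (by simpa using hcon)] at hx
    omega
  · by_contra hcon
    have h : ldes (insertMax i.castSucc π) ≤ i := by omega
    rw [ldes_le_iff] at h
    have := h i.castSucc (i.castSucc.succAbove i) (by simp) (by simp)
    rw [insertMax_self] at this
    exact absurd this (not_lt.mpr (Fin.le_last _))

lemma avoids321_insertMax_iff (i : Fin (m + 1)) (π : Equiv.Perm (Fin m)) :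
    Avoids321 (insertMax i π) ↔ Avoids321 π ∧ ldes π ≤ i := by
  rw [ldes_le_iff]
  constructor
  · intro h
    constructor
    · rintro ⟨a, b, c, hab, hbc, h1, h2⟩
      refine h ⟨i.succAbove a, i.succAbove b, i.succAbove c, ?_, ?_, ?_, ?_⟩ <;> simpa
    · intro x y hx hxy
      by_contra hcon
      have hne : π x ≠ π y := fun he => hxy.ne (π.injective he)
      refine h ⟨i, i.succAbove x, i.succAbove y, ?_, by simpa, ?_, ?_⟩
      · rw [Fin.lt_def, val_succAbove_of_le _ _ hx]; omega
      · simpa using lt_of_le_of_ne (not_lt.mp hcon) hne.symm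
      · simp [Fin.castSucc_lt_last]
  · rintro ⟨h, hi⟩ ⟨a, b, c, hab, hbc, h1, h2⟩
    rcases Fin.eq_self_or_eq_succAbove i b with rfl | ⟨b, rfl⟩
    · rw [insertMax_self] at h2; exact absurd h2 (not_lt.mpr (Fin.le_last _))
    rcases Fin.eq_self_or_eq_succAbove i c with rfl | ⟨c, rfl⟩
    · rw [insertMax_self] at h1; exact absurd h1 (not_lt.mpr (Fin.le_last _))
    simp only [insertMax_succAbove, Fin.castSucc_lt_castSucc_iff,
      Fin.succAbove_lt_succAbove_iff] at h1 hbc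
    rcases Fin.eq_self_or_eq_succAbove i a with rfl | ⟨a, rfl⟩
    · refine absurd h1 (not_lt.mpr (hi b c ?_ hbc).le)
      by_contra hcon
      rw [Fin.lt_def, val_succAbove_of_lt _ _ (by omega)] at hab
      omega
    · simp only [insertMax_succAbove, Fin.castSucc_lt_castSucc_iff,
        Fin.succAbove_lt_succAbove_iff] at h2 hab
      exact h ⟨a, b, c, hab, hbc, h1, h2⟩

/-- `s` is a set of positions of an increasing subsequence among the first `i` entries of `π`. -/
def IsIncBelow (π : Equiv.Perm (Fin m)) (i : ℕ) (s : Finset (Fin m)) : Prop :=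
  (∀ x ∈ s, ∀ y ∈ s, x < y → π x < π y) ∧ ∀ x ∈ s, (x : ℕ) < i

/-- The length of the longest increasing subsequence among the first `i` entries of `π`. -/
noncomputable def prefixLis (π : Equiv.Perm (Fin m)) (i : ℕ) : ℕ :=
  (Finset.univ.filter (IsIncBelow π i)).sup Finset.card

lemma prefixLis_le_iff (π : Equiv.Perm (Fin m)) (i k : ℕ) :
    prefixLis π i ≤ k ↔ ∀ s, IsIncBelow π i s → s.card ≤ k := by
  simp [prefixLis, Finset.sup_le_iff]

lemma IsIncBelow.card_le {π : Equiv.Perm (Fin m)} {i : ℕ} {s : Finset (Fin m)}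
    (h : IsIncBelow π i s) : s.card ≤ prefixLis π i :=
  (prefixLis_le_iff π i _).mp le_rfl s h

lemma exists_isIncBelow (π : Equiv.Perm (Fin m)) (i : ℕ) :
    ∃ s, IsIncBelow π i s ∧ s.card = prefixLis π i := by
  obtain ⟨s, hs, he⟩ := Finset.exists_mem_eq_sup (Finset.univ.filter (IsIncBelow π i))
    ⟨∅, by simp [IsIncBelow]⟩ Finset.card
  exact ⟨s, (Finset.mem_filter.mp hs).2, he.symm⟩

lemma lis_eq_prefixLis (π : Equiv.Perm (Fin m)) : lis π = prefixLis π m := by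
  apply le_antisymm
  · refine csSup_le ⟨0, ∅, by simp⟩ ?_
    rintro k ⟨s, hs, rfl⟩
    exact IsIncBelow.card_le ⟨hs, fun x _ => x.2⟩
  · obtain ⟨s, hs, he⟩ := exists_isIncBelow π m
    refine le_csSup ⟨m, ?_⟩ ⟨s, hs.1, he⟩
    rintro k ⟨t, -, rfl⟩
    simpa using Finset.card_le_univ t

lemma prefixLis_mono (π : Equiv.Perm (Fin m)) : Monotone (prefixLis π) := by
  intro i j hij
  rw [prefixLis_le_iff]
  exact fun s hs => IsIncBelow.card_le ⟨hs.1, fun x hx => (hs.2 x hx).trans_le hij⟩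

lemma prefixLis_zero (π : Equiv.Perm (Fin m)) : prefixLis π 0 = 0 := by
  rw [← Nat.le_zero, prefixLis_le_iff]
  intro s hs
  rw [Nat.le_zero, Finset.card_eq_zero, Finset.eq_empty_iff_forall_notMem]
  exact fun x hx => absurd (hs.2 x hx) (by omega)

lemma exists_eq_map_succAbove (i : Fin (m + 1)) (s : Finset (Fin (m + 1))) (hi : i ∉ s) :
    ∃ t : Finset (Fin m), s = t.map i.succAboveEmb := by
  refine ⟨Finset.univ.filter fun x => i.succAbove x ∈ s, ?_⟩
  ext y
  rcases Fin.eq_self_or_eq_succAbove i y with rfl | ⟨y, rfl⟩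
  · simpa using hi
  · simp

lemma inc_map_succAbove_iff (i : Fin (m + 1)) (π : Equiv.Perm (Fin m)) (t : Finset (Fin m)) :
    (∀ x ∈ t.map i.succAboveEmb, ∀ y ∈ t.map i.succAboveEmb,
      x < y → insertMax i π x < insertMax i π y) ↔ ∀ x ∈ t, ∀ y ∈ t, x < y → π x < π y := by
  simp

lemma succAbove_lt_of_le (i : Fin (m + 1)) (x : Fin m) {k : ℕ} (hk : k ≤ i) :
    (i.succAbove x : ℕ) < k ↔ (x : ℕ) < k := by
  rcases lt_or_ge (x : ℕ) i with h | h
  · rw [val_succAbove_of_lt _ _ h]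
  · rw [val_succAbove_of_le _ _ h]; omega

lemma succAbove_lt_succ_of_le (i : Fin (m + 1)) (x : Fin m) {k : ℕ} (hk : (i : ℕ) ≤ k) :
    (i.succAbove x : ℕ) < k + 1 ↔ (x : ℕ) < k := by
  rcases lt_or_ge (x : ℕ) i with h | h
  · rw [val_succAbove_of_lt _ _ h]; omega
  · rw [val_succAbove_of_le _ _ h]; omega

lemma prefixLis_insertMax_of_le (i : Fin (m + 1)) (π : Equiv.Perm (Fin m)) {k : ℕ} (hk : k ≤ i) :
    prefixLis (insertMax i π) k = prefixLis π k := by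
  apply le_antisymm
  · rw [prefixLis_le_iff]
    intro s hs
    obtain ⟨t, rfl⟩ := exists_eq_map_succAbove i s fun h => absurd (hs.2 i h) (by omega)
    rw [Finset.card_map]
    refine IsIncBelow.card_le ⟨(inc_map_succAbove_iff i π t).mp hs.1, fun x hx => ?_⟩
    exact (succAbove_lt_of_le i x hk).mp (hs.2 _ (Finset.mem_map_of_mem _ hx))
  · rw [prefixLis_le_iff]
    intro t ht
    rw [← Finset.card_map i.succAboveEmb]
    refine IsIncBelow.card_le ⟨(inc_map_succAbove_iff i π t).mpr ht.1, ?_⟩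
    simpa [succAbove_lt_of_le i _ hk] using ht.2

lemma prefixLis_insertMax_succ (i : Fin (m + 1)) (π : Equiv.Perm (Fin m)) {k : ℕ}
    (hk : (i : ℕ) ≤ k) :
    prefixLis (insertMax i π) (k + 1) = max (prefixLis π k) (prefixLis π i + 1) := by
  apply le_antisymm
  · rw [prefixLis_le_iff]
    intro s hs
    by_cases hi : i ∈ s
    · refine le_max_of_le_right ?_
      have hlt : ∀ x ∈ s.erase i, x < i := by
        intro x hx
        rw [Finset.mem_erase] at hx
        refine lt_of_le_of_ne (not_lt.mp fun hlt => ?_) hx.1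
        have := hs.1 i hi x hx.2 hlt
        rw [insertMax_self] at this
        exact absurd this (not_lt.mpr (Fin.le_last _))
      rw [← Finset.card_erase_add_one hi, ← prefixLis_insertMax_of_le i π le_rfl]
      refine Nat.succ_le_succ (IsIncBelow.card_le ⟨fun x hx y hy => ?_, hlt⟩)
      exact hs.1 x (Finset.mem_of_mem_erase hx) y (Finset.mem_of_mem_erase hy)
    · refine le_max_of_le_left ?_
      obtain ⟨t, rfl⟩ := exists_eq_map_succAbove i s hi
      rw [Finset.card_map]
      refine IsIncBelow.card_le ⟨(inc_map_succAbove_iff i π t).mp hs.1, fun x hx => ?_⟩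
      exact (succAbove_lt_succ_of_le i x hk).mp (hs.2 _ (Finset.mem_map_of_mem _ hx))
  · apply max_le
    · rw [prefixLis_le_iff]
      intro t ht
      rw [← Finset.card_map i.succAboveEmb]
      refine IsIncBelow.card_le ⟨(inc_map_succAbove_iff i π t).mpr ht.1, fun x hx => ?_⟩
      obtain ⟨y, hy, rfl⟩ := Finset.mem_map.mp hx
      exact (succAbove_lt_succ_of_le i y hk).mpr (ht.2 y hy)
    · obtain ⟨s, hs, he⟩ := exists_isIncBelow (insertMax i π) i
      rw [← prefixLis_insertMax_of_le i π le_rfl, ← he,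
        ← Finset.card_insert_of_notMem (fun h => absurd (hs.2 i h) (by omega) : i ∉ s)]
      refine IsIncBelow.card_le ⟨?_, ?_⟩
      · intro x hx y hy hxy
        rw [Finset.mem_insert] at hx hy
        rcases hx with rfl | hx
        · rcases hy with rfl | hy
          · exact absurd hxy (lt_irrefl _)
          · exact absurd hxy (not_lt.mpr (Fin.lt_def.mpr (hs.2 y hy)).le)
        · rcases hy with rfl | hy
          · rw [insertMax_self]
            refine lt_of_le_of_ne (Fin.le_last _) fun h => hxy.ne ?_
            apply (insertMax y π).injective
            rw [h, insertMax_self]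
          · exact hs.1 x hx y hy hxy
      · intro x hx
        rw [Finset.mem_insert] at hx
        rcases hx with rfl | hx
        · omega
        · have := hs.2 x hx; omega

/-- Past the last descent of a 321-avoiding permutation, the length of the longest increasing
subsequence of a prefix is first constant and then grows by one at every step. -/
lemma prefixLis_eq_max {m : ℕ} (π : Equiv.Perm (Fin m)) (hπ : Avoids321 π) {k : ℕ}
    (h1 : ldes π ≤ k) (h2 : k ≤ m) :
    prefixLis π k = max (prefixLis π (ldes π)) (lis π + k - m) := by
  induction m generalizing k with
  | zero =>
    obtain rfl : k = 0 := by omega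
    have : ldes π = 0 := by omega
    simp [this, lis_eq_prefixLis, prefixLis_zero]
  | succ m ih =>
    obtain ⟨⟨i, σ⟩, rfl⟩ := insertMax_bijective.surjective π
    simp only at hπ h1 h2 ⊢
    rw [avoids321_insertMax_iff] at hπ
    obtain ⟨hσ, hi⟩ := hπ
    have hm := ih σ hσ (ldes_le σ) le_rfl
    have hmi := ih σ hσ hi (by omega)
    have mono1 := prefixLis_mono σ (ldes_le σ)
    rw [lis_eq_prefixLis] at hm hmi ⊢
    rw [prefixLis_insertMax_succ i σ (by omega)]
    rcases Fin.eq_castSucc_or_eq_last i with ⟨i, rfl⟩ | rfl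
    · rw [Fin.val_castSucc] at hi hmi
      rw [ldes_insertMax_castSucc σ i hi] at h1 ⊢
      obtain ⟨k, rfl⟩ : ∃ l, k = l + 1 := ⟨k - 1, by omega⟩
      have hmk := ih σ hσ (k := k) (by omega) (by omega)
      rw [lis_eq_prefixLis] at hmk
      rw [prefixLis_insertMax_succ _ σ (by simp only [Fin.val_castSucc]; omega),
        prefixLis_insertMax_succ _ σ (by simp only [Fin.val_castSucc]; omega), Fin.val_castSucc]
      omega
    · rw [ldes_insertMax_last] at h1 ⊢
      rw [prefixLis_insertMax_of_le _ σ (k := ldes σ) (by simpa using ldes_le σ), Fin.val_last]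
      rcases Nat.lt_or_ge m k with hk | hk
      · obtain rfl : k = m + 1 := by omega
        rw [prefixLis_insertMax_succ _ σ (by simp), Fin.val_last]
        omega
      · rw [prefixLis_insertMax_of_le _ σ (k := k) (by simpa using hk), ih σ hσ h1 hk,
          lis_eq_prefixLis]
        omega

end insertMax

/-- The weighted number of ballot words of length `j` with `c` up-steps, where an up-step
preceded by `b` down-steps has weight `e ^ b`. -/
def ballotSum (e : ℤ) : ℕ → ℕ → ℤ
  | 0, c => if c = 0 then 1 else 0
  | j + 1, c =>
    if j + 1 ≤ 2 * c then e ^ (j + 1 - c) * ballotSum e j (c - 1) + ballotSum e j c else 0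

section ballotSum

variable (e : ℤ)

lemma ballotSum_succ {j c : ℕ} (h : j + 1 ≤ 2 * c) :
    ballotSum e (j + 1) c = e ^ (j + 1 - c) * ballotSum e j (c - 1) + ballotSum e j c := by
  rw [ballotSum, if_pos h]

lemma ballotSum_of_two_mul_lt {j c : ℕ} (h : 2 * c < j) : ballotSum e j c = 0 := by
  obtain ⟨j, rfl⟩ : ∃ k, j = k + 1 := ⟨j - 1, by omega⟩
  rw [ballotSum, if_neg (by omega)]

lemma ballotSum_of_lt {j c : ℕ} (h : j < c) : ballotSum e j c = 0 := by
  induction j generalizing c with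
  | zero => rw [ballotSum, if_neg (by omega)]
  | succ j ih => rw [ballotSum_succ e (by omega), ih (by omega), ih (by omega)]; simp

lemma ballotSum_self (j : ℕ) : ballotSum e j j = 1 := by
  induction j with
  | zero => simp [ballotSum]
  | succ j ih => rw [ballotSum_succ e (by omega), ballotSum_of_lt e j.lt_succ_self]; simpa

lemma ballotSum_neg_one_odd_of {N : ℕ}
    (h1 : ∀ a, ballotSum (-1) (2 * N + 1) (2 * a + 1) = ballotSum 1 N a)
    (h2 : ∀ a, ballotSum (-1) (2 * N + 1) (2 * a) = 0) (a : ℕ) :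
    ballotSum (-1) (2 * N + 2) (2 * a + 1) = ballotSum 1 N a := by
  by_cases h : 2 * N + 2 ≤ 2 * (2 * a + 1)
  · rw [ballotSum_succ _ h, h1, Nat.add_sub_cancel, h2]; simp
  · rw [ballotSum_of_two_mul_lt _ (by omega), ballotSum_of_two_mul_lt _ (by omega)]

lemma ballotSum_neg_one_even_of {N : ℕ}
    (h1 : ∀ a, ballotSum (-1) (2 * N + 1) (2 * a + 1) = ballotSum 1 N a)
    (h2 : ∀ a, ballotSum (-1) (2 * N + 1) (2 * a) = 0) (a : ℕ) :
    ballotSum (-1) (2 * N + 2) (2 * a + 2) = ballotSum 1 N a := by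
  by_cases h : 2 * N + 2 ≤ 2 * (2 * a + 2)
  · have h3 := h2 (a + 1)
    rw [ballotSum_succ _ h, show 2 * a + 2 - 1 = 2 * a + 1 from rfl, h1,
      show 2 * a + 2 = 2 * (a + 1) from rfl, h3,
      show 2 * N + 1 + 1 - 2 * (a + 1) = 2 * (N - a) by omega, pow_mul]
    simp
  · rw [ballotSum_of_two_mul_lt _ (by omega), ballotSum_of_two_mul_lt _ (by omega)]

lemma ballotSum_neg_one (N : ℕ) :
    (∀ a, ballotSum (-1) (2 * N + 1) (2 * a + 1) = ballotSum 1 N a) ∧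
    (∀ a, ballotSum (-1) (2 * N + 1) (2 * a) = 0) := by
  induction N with
  | zero =>
    refine ⟨fun a => ?_, fun a => ?_⟩
    · rcases a with _ | a
      · simp [ballotSum]
      · rw [ballotSum_of_lt _ (by omega), ballotSum_of_lt _ (by omega)]
    · rcases a with _ | a
      · simp [ballotSum]
      · rw [ballotSum_of_lt _ (by omega)]
  | succ N ih =>
    obtain ⟨ih1, ih2⟩ := ih
    have odd := ballotSum_neg_one_odd_of ih1 ih2
    have even := ballotSum_neg_one_even_of ih1 ih2
    refine ⟨fun a => ?_, fun a => ?_⟩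
    · by_cases h : N + 1 ≤ 2 * a
      · obtain ⟨a, rfl⟩ : ∃ b, a = b + 1 := ⟨a - 1, by omega⟩
        rw [ballotSum_succ _ h, ballotSum_succ _ (by omega),
          show 2 * (a + 1) + 1 - 1 = 2 * a + 2 from rfl, Nat.add_sub_cancel]
        rw [show 2 * (N + 1) = 2 * N + 2 from rfl, even, odd,
          show 2 * N + 2 + 1 - (2 * (a + 1) + 1) = 2 * (N - a) by omega, pow_mul]
        simp
      · rw [ballotSum_of_two_mul_lt _ (by omega : 2 * a < N + 1)]
        by_cases h' : 2 * (N + 1) + 1 ≤ 2 * (2 * a + 1)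
        · omega
        · rw [ballotSum_of_two_mul_lt _ (by omega)]
    · rcases a with _ | a
      · rw [ballotSum_of_two_mul_lt _ (by omega)]
      by_cases h : 2 * (N + 1) + 1 ≤ 2 * (2 * (a + 1))
      · rw [ballotSum_succ _ h, show 2 * (a + 1) - 1 = 2 * a + 1 from rfl,
          show 2 * (N + 1) = 2 * N + 2 from rfl, odd, show 2 * (a + 1) = 2 * a + 2 from rfl, even]
        rcases Nat.lt_or_ge N a with h' | h'
        · rw [ballotSum_of_lt _ h']; simp
        · rw [show 2 * N + 2 + 1 - (2 * a + 2) = 2 * (N - a) + 1 by omega, pow_add, pow_mul]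
          simp
      · rw [ballotSum_of_two_mul_lt _ (by omega)]

lemma ballotSum_neg_one_odd (N a : ℕ) :
    ballotSum (-1) (2 * N + 2) (2 * a + 1) = ballotSum 1 N a :=
  ballotSum_neg_one_odd_of (ballotSum_neg_one N).1 (ballotSum_neg_one N).2 a

lemma ballotSum_neg_one_even (N a : ℕ) :
    ballotSum (-1) (2 * N + 2) (2 * a + 2) = ballotSum 1 N a :=
  ballotSum_neg_one_even_of (ballotSum_neg_one N).1 (ballotSum_neg_one N).2 a

end ballotSum

section weightedSums

variable (χ : ℤˣ →* ℤ)

/-- The `χ ∘ sign`-weighted number of 321-avoiding permutations of `Fin m` with last descent `j`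
and longest increasing subsequence of length `L`, whose first `j` entries have longest increasing
subsequence of length `c`. -/
noncomputable def exactSum (m j c L : ℕ) : ℤ :=
  ∑ π : Equiv.Perm (Fin m),
    if Avoids321 π ∧ ldes π = j ∧ prefixLis π j = c ∧ lis π = L then χ (Equiv.Perm.sign π) else 0

/-- The analogue of `exactSum` for permutations with last descent at most `j`. -/
noncomputable def boundedSum (m j c L : ℕ) : ℤ :=
  ∑ π : Equiv.Perm (Fin m),
    if Avoids321 π ∧ ldes π ≤ j ∧ prefixLis π j = c ∧ lis π = L then χ (Equiv.Perm.sign π) else 0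

lemma sum_perm_succ {m : ℕ} (f : Equiv.Perm (Fin (m + 1)) → ℤ) :
    ∑ π, f π = ∑ π : Equiv.Perm (Fin m),
      (∑ i : Fin m, f (insertMax i.castSucc π) + f (insertMax (Fin.last m) π)) := by
  rw [← Fintype.sum_bijective _ insertMax_bijective (fun p => f (insertMax p.1 p.2)) f
    fun _ => rfl, Fintype.sum_prod_type_right]
  exact Finset.sum_congr rfl fun π _ => Fin.sum_univ_castSucc _

lemma lis_insertMax_castSucc {m : ℕ} (i : Fin m) (π : Equiv.Perm (Fin m)) :
    lis (insertMax i.castSucc π) = max (lis π) (prefixLis π i + 1) := by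
  rw [lis_eq_prefixLis, lis_eq_prefixLis, prefixLis_insertMax_succ _ _ (by simp [i.2.le])]
  simp

lemma lis_insertMax_last {m : ℕ} (π : Equiv.Perm (Fin m)) :
    lis (insertMax (Fin.last m) π) = lis π + 1 := by
  rw [lis_eq_prefixLis, lis_eq_prefixLis, prefixLis_insertMax_succ _ _ (by simp)]
  simp

lemma append_term {m : ℕ} (π : Equiv.Perm (Fin m)) (j c L : ℕ) :
    (if Avoids321 (insertMax (Fin.last m) π) ∧ ldes (insertMax (Fin.last m) π) = j ∧
        prefixLis (insertMax (Fin.last m) π) j = c ∧ lis (insertMax (Fin.last m) π) = L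
      then χ (Equiv.Perm.sign (insertMax (Fin.last m) π)) else 0) =
    if 1 ≤ L then
      if Avoids321 π ∧ ldes π = j ∧ prefixLis π j = c ∧ lis π = L - 1
        then χ (Equiv.Perm.sign π) else 0
    else 0 := by
  rw [← ite_and]
  have hm := ldes_le π
  refine if_congr ?_ (by simp [sign_insertMax]) rfl
  rw [avoids321_insertMax_iff, ldes_insertMax_last, lis_insertMax_last]
  constructor
  · rintro ⟨⟨h1, -⟩, h2, h3, h4⟩
    rw [prefixLis_insertMax_of_le _ _ (by rw [Fin.val_last]; omega)] at h3
    exact ⟨by omega, h1, h2, h3, by omega⟩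
  · rintro ⟨h0, h1, h2, h3, h4⟩
    rw [prefixLis_insertMax_of_le _ _ (by rw [Fin.val_last]; omega)]
    exact ⟨⟨h1, hm⟩, h2, h3, by omega⟩

lemma insert_term {m : ℕ} (π : Equiv.Perm (Fin m)) (i : Fin m) (j c L : ℕ) :
    (if Avoids321 (insertMax i.castSucc π) ∧ ldes (insertMax i.castSucc π) = j ∧
        prefixLis (insertMax i.castSucc π) j = c ∧ lis (insertMax i.castSucc π) = L
      then χ (Equiv.Perm.sign (insertMax i.castSucc π)) else 0) =
    if (i : ℕ) + 1 = j ∧ Avoids321 π ∧ ldes π ≤ i ∧ prefixLis π i + 1 = c ∧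
        max (lis π) (prefixLis π i + 1) = L
      then χ (-1) ^ (m - i : ℕ) * χ (Equiv.Perm.sign π) else 0 := by
  have hp : prefixLis (insertMax i.castSucc π) (i + 1) = prefixLis π i + 1 := by
    rw [prefixLis_insertMax_succ _ _ (by simp)]; simp
  refine if_congr ?_ (by simp [sign_insertMax]) rfl
  rw [avoids321_insertMax_iff, lis_insertMax_castSucc]
  constructor
  · rintro ⟨⟨h1, h2⟩, h3, h4, h5⟩
    rw [ldes_insertMax_castSucc _ _ h2] at h3
    subst h3
    exact ⟨rfl, h1, h2, by rw [← h4, hp], h5⟩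
  · rintro ⟨rfl, h1, h2, h4, h5⟩
    exact ⟨⟨h1, h2⟩, ldes_insertMax_castSucc _ _ h2, by rw [hp, h4], h5⟩

lemma exactSum_succ_zero (m c L : ℕ) :
    exactSum χ (m + 1) 0 c L = if 1 ≤ L then exactSum χ m 0 c (L - 1) else 0 := by
  rw [exactSum, sum_perm_succ]
  simp only [append_term, insert_term, Nat.succ_ne_zero, false_and, if_false,
    Finset.sum_const_zero, zero_add]
  split_ifs
  · rfl
  · exact Finset.sum_const_zero

lemma exactSum_succ_succ {m i : ℕ} (hi : i < m) (c L : ℕ) :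
    exactSum χ (m + 1) (i + 1) (c + 1) L =
      (if 1 ≤ L then exactSum χ m (i + 1) (c + 1) (L - 1) else 0) +
      χ (-1) ^ (m - i) *
        (if c + 1 < L then boundedSum χ m i c L
        else if c + 1 = L then boundedSum χ m i c c + boundedSum χ m i c (c + 1)
        else 0) := by
  rw [exactSum, sum_perm_succ, Finset.sum_add_distrib, add_comm]
  simp only [append_term, insert_term]
  congr 1
  · split_ifs
    · rfl
    · exact Finset.sum_const_zero
  · have hsum (π : Equiv.Perm (Fin m)) :
        (∑ b : Fin m, if (b : ℕ) + 1 = i + 1 ∧ Avoids321 π ∧ ldes π ≤ b ∧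
            prefixLis π b + 1 = c + 1 ∧ max (lis π) (prefixLis π b + 1) = L
          then χ (-1) ^ (m - b : ℕ) * χ (Equiv.Perm.sign π) else 0) =
        if Avoids321 π ∧ ldes π ≤ i ∧ prefixLis π i = c ∧ max (lis π) (c + 1) = L
          then χ (-1) ^ (m - i : ℕ) * χ (Equiv.Perm.sign π) else 0 := by
      rw [Finset.sum_eq_single ⟨i, hi⟩
        (fun b _ hb => if_neg fun h => hb (Fin.ext (by simpa using h.1)))
        (fun h => absurd (Finset.mem_univ _) h)]
      refine if_congr ⟨?_, ?_⟩ rfl rfl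
      · rintro ⟨-, h1, h2, h3, h4⟩
        have h3' : prefixLis π i + 1 = c + 1 := h3
        have h4' : max (lis π) (prefixLis π i + 1) = L := h4
        exact ⟨h1, h2, by omega, by omega⟩
      · rintro ⟨h1, h2, h3, h4⟩
        exact ⟨rfl, h1, h2, congrArg (· + 1) h3, by rw [← h4, ← h3]⟩
    rw [Finset.sum_congr rfl fun π _ => hsum π]
    have hp (π : Equiv.Perm (Fin m)) : prefixLis π i ≤ lis π := by
      rw [lis_eq_prefixLis]; exact prefixLis_mono π hi.le
    rcases lt_trichotomy (c + 1) L with h | h | h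
    · rw [if_pos h, boundedSum, Finset.mul_sum]
      refine Finset.sum_congr rfl fun π _ => ?_
      rw [mul_ite, mul_zero]
      have := hp π
      exact if_congr (and_congr_right fun _ => by omega) rfl rfl
    · rw [if_neg (by omega), if_pos h, boundedSum, boundedSum, ← Finset.sum_add_distrib,
        Finset.mul_sum]
      refine Finset.sum_congr rfl fun π _ => ?_
      have := hp π
      by_cases ha : Avoids321 π
      · simp only [ha, true_and]
        split_ifs <;> first | omega | simp
      · simp only [ha, false_and, if_false, add_zero, mul_zero]
    · rw [if_neg (by omega), if_neg (by omega), mul_zero]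
      refine Finset.sum_eq_zero fun π _ => if_neg ?_
      rintro ⟨-, -, -, h'⟩
      omega

lemma exactSum_succ_succ_zero (m i L : ℕ) :
    exactSum χ (m + 1) (i + 1) 0 L =
      if 1 ≤ L then exactSum χ m (i + 1) 0 (L - 1) else 0 := by
  rw [exactSum, sum_perm_succ]
  simp only [append_term, insert_term, Nat.succ_ne_zero, false_and, and_false, if_false,
    Finset.sum_const_zero, zero_add]
  split_ifs
  · rfl
  · exact Finset.sum_const_zero

lemma exactSum_of_lt {m j : ℕ} (h : m < j) (c L : ℕ) : exactSum χ (m + 1) j c L = 0 := by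
  refine Finset.sum_eq_zero fun π _ => if_neg ?_
  rintro ⟨-, h1, -⟩
  have := ldes_lt π
  omega

lemma exactSum_zero (j c L : ℕ) :
    exactSum χ 0 j c L = if j = 0 ∧ c = 0 ∧ L = 0 then 1 else 0 := by
  rw [exactSum, Fintype.sum_unique]
  have h1 : ldes (default : Equiv.Perm (Fin 0)) = 0 := Nat.le_zero.mp (ldes_le _)
  have h2 : lis (default : Equiv.Perm (Fin 0)) = 0 := by rw [lis_eq_prefixLis, prefixLis_zero]
  have h3 : Avoids321 (default : Equiv.Perm (Fin 0)) := fun ⟨i, _⟩ => i.elim0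
  have h4 : χ (Equiv.Perm.sign (default : Equiv.Perm (Fin 0))) = 1 := by
    rw [Subsingleton.elim (default : Equiv.Perm (Fin 0)) 1, map_one, map_one]
  rw [h1, h2, h4]
  refine if_congr ⟨?_, ?_⟩ rfl rfl
  · rintro ⟨-, rfl, h, rfl⟩
    exact ⟨rfl, by rw [← h, prefixLis_zero], rfl⟩
  · rintro ⟨rfl, rfl, rfl⟩
    exact ⟨h3, rfl, prefixLis_zero _, rfl⟩

lemma boundedSum_zero (m c L : ℕ) : boundedSum χ m 0 c L = exactSum χ m 0 c L := by
  simp only [boundedSum, exactSum, Nat.le_zero]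

lemma boundedSum_succ {m j : ℕ} (hj : j + 1 ≤ m) (c L : ℕ) :
    boundedSum χ m (j + 1) c L = exactSum χ m (j + 1) c L +
      (if L + j + 1 < m + c then boundedSum χ m j c L
      else if L + j + 1 = m + c then boundedSum χ m j c L +
        (if c = 0 then 0 else boundedSum χ m j (c - 1) L)
      else 0) := by
  have hinv (π : Equiv.Perm (Fin m)) (ha : Avoids321 π) (hl : ldes π ≤ j) :
      prefixLis π (j + 1) = max (prefixLis π j) (lis π + (j + 1) - m) ∧
        lis π + j - m ≤ prefixLis π j := by
    have h1 := prefixLis_eq_max π ha hl (by omega)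
    have h2 := prefixLis_eq_max π ha (k := j + 1) (by omega) hj
    omega
  have hterm (π : Equiv.Perm (Fin m)) (x : ℤ)
      (h : Avoids321 π → ldes π ≤ j → lis π = L → x =
        if prefixLis π (j + 1) = c then χ (Equiv.Perm.sign π) else 0)
      (h' : ¬ (Avoids321 π ∧ ldes π ≤ j ∧ lis π = L) → x = 0) :
      (if Avoids321 π ∧ ldes π ≤ j + 1 ∧ prefixLis π (j + 1) = c ∧ lis π = L
        then χ (Equiv.Perm.sign π) else 0) =
      (if Avoids321 π ∧ ldes π = j + 1 ∧ prefixLis π (j + 1) = c ∧ lis π = L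
        then χ (Equiv.Perm.sign π) else 0) + x := by
    by_cases ha : Avoids321 π ∧ ldes π ≤ j ∧ lis π = L
    · obtain ⟨ha, hl, hL⟩ := ha
      rw [h ha hl hL]
      simp only [ha, true_and]
      split_ifs <;> omega
    · rw [h' ha, add_zero]
      refine if_congr (and_congr_right fun ha' => ?_) rfl rfl
      simp only [ha', true_and] at ha
      omega
  rw [boundedSum, exactSum]
  rcases lt_trichotomy (L + j + 1) (m + c) with h | h | h
  · rw [if_pos h, boundedSum, ← Finset.sum_add_distrib]
    refine Finset.sum_congr rfl fun π _ => hterm π _ (fun ha hl hL => ?_) fun h' => ?_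
    · have := hinv π ha hl
      exact if_congr (by simp only [ha, true_and]; omega) rfl rfl
    · exact if_neg fun h => h' ⟨h.1, h.2.1, h.2.2.2⟩
  · rw [if_neg (by omega), if_pos h]
    rcases c with _ | c
    · rw [if_pos rfl, add_zero, boundedSum, ← Finset.sum_add_distrib]
      refine Finset.sum_congr rfl fun π _ => hterm π _ (fun ha hl hL => ?_) fun h' => ?_
      · have := hinv π ha hl
        exact if_congr (by simp only [ha, true_and]; omega) rfl rfl
      · exact if_neg fun h => h' ⟨h.1, h.2.1, h.2.2.2⟩
    · rw [if_neg c.succ_ne_zero, boundedSum, boundedSum, ← Finset.sum_add_distrib,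
        ← Finset.sum_add_distrib]
      refine Finset.sum_congr rfl fun π _ => hterm π _ (fun ha hl hL => ?_) fun h' => ?_
      · have := hinv π ha hl
        simp only [ha, true_and]
        split_ifs <;> omega
      · rw [if_neg fun h => h' ⟨h.1, h.2.1, h.2.2.2⟩, if_neg fun h => h' ⟨h.1, h.2.1, h.2.2.2⟩,
          add_zero]
  · rw [if_neg (by omega), if_neg (by omega), add_zero]
    refine Finset.sum_congr rfl fun π _ => ?_
    rw [hterm π 0 (fun ha hl hL => ?_) fun _ => rfl, add_zero]
    have := hinv π ha hl
    rw [if_neg (by omega)]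

lemma exactSum_at_zero (m c L : ℕ) :
    exactSum χ m 0 c L = if c = 0 ∧ L = m then 1 else 0 := by
  induction m generalizing L with
  | zero => simp [exactSum_zero]
  | succ m ih =>
    rw [exactSum_succ_zero, ih, ← ite_and]
    exact if_congr (by omega) rfl rfl

lemma boundedSum_eq_of_exactSum_eq {m : ℕ}
    (hm : ∀ j c L, exactSum χ m (j + 1) c L =
      if 1 ≤ c ∧ c ≤ L ∧ L + j + 2 ≤ m + c ∧ m ≤ L + c then
        χ (-1) ^ ((m - L) * (1 + L - c) + (j + 1 - c)) * ballotSum (χ (-1)) m L *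
          ballotSum (χ (-1)) j (c - 1) else 0)
    {j : ℕ} (hj : j ≤ m) (c L : ℕ) :
    boundedSum χ m j c L =
      if c ≤ L ∧ L + j ≤ m + c ∧ m ≤ L + c then
        χ (-1) ^ ((m - L) * (1 + L - c)) * ballotSum (χ (-1)) m L * ballotSum (χ (-1)) j c
      else 0 := by
  induction j generalizing c with
  | zero =>
    rw [boundedSum_zero, exactSum_at_zero]
    rcases Nat.eq_zero_or_pos c with rfl | hc
    · by_cases h : L = m
      · subst h; simp [ballotSum_self, ballotSum]
      · rw [if_neg (by omega), if_neg (by omega)]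
    · rw [if_neg (by omega), ballotSum_of_lt _ hc, mul_zero, ite_self]
  | succ j ih =>
    rw [boundedSum_succ χ hj, hm, ih (by omega), ih (by omega)]
    by_cases G : c ≤ L ∧ L + (j + 1) ≤ m + c ∧ m ≤ L + c
    · obtain ⟨c, rfl⟩ : ∃ d, c = d + 1 := ⟨c - 1, by omega⟩
      rw [if_pos G, ballotSum_succ _ (by omega), Nat.add_sub_cancel]
      rcases Nat.lt_or_ge (L + j + 1) (m + (c + 1)) with h | h
      · rw [if_pos (by omega), if_pos h, if_pos (by omega)]
        ring
      · rw [if_neg (by omega), if_neg (by omega), if_pos (by omega), if_pos (by omega),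
          if_neg (by omega)]
        have e1 : (m - L) * (1 + L - c) = (m - L) * (1 + L - (c + 1)) + (j + 1 - (c + 1)) := by
          rw [show 1 + L - c = (1 + L - (c + 1)) + 1 by omega,
            show j + 1 - (c + 1) = m - L by omega, mul_add, mul_one]
        by_cases h' : m ≤ L + c
        · rw [if_pos (by omega), e1]
          ring
        · rw [if_neg (by omega), ballotSum_of_two_mul_lt _ (by omega : 2 * c < j)]
          ring
    · rw [if_neg G, if_neg (by omega)]
      split_ifs <;> omega

lemma exactSum_eq (m j c L : ℕ) :
    exactSum χ m (j + 1) c L =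
      if 1 ≤ c ∧ c ≤ L ∧ L + j + 2 ≤ m + c ∧ m ≤ L + c then
        χ (-1) ^ ((m - L) * (1 + L - c) + (j + 1 - c)) * ballotSum (χ (-1)) m L *
          ballotSum (χ (-1)) j (c - 1) else 0 := by
  induction m generalizing j c L with
  | zero => rw [exactSum_zero, if_neg (by omega), if_neg (by omega)]
  | succ m ih =>
    have hb := fun {j} (hj : j ≤ m) => boundedSum_eq_of_exactSum_eq χ ih hj
    have hχ : χ (-1) ^ 2 = 1 := by rw [← map_pow]; simp
    have parity {a b x y : ℕ} (h : a + 2 * x = b + 2 * y) : χ (-1) ^ a = χ (-1) ^ b := by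
      have := congrArg (χ (-1) ^ ·) h
      simpa only [pow_add, pow_mul, hχ, one_pow, mul_one] using this
    rcases Nat.lt_or_ge j m with hj | hj
    swap
    · rw [exactSum_of_lt χ (by omega), if_neg (by omega)]
    rcases c with _ | c
    · rw [exactSum_succ_succ_zero, ih]
      split_ifs <;> omega
    rw [exactSum_succ_succ χ hj, ih, hb hj.le, hb hj.le, hb hj.le]
    simp only [Nat.add_sub_cancel]
    by_cases G : 1 ≤ c + 1 ∧ c + 1 ≤ L ∧ L + j + 2 ≤ m + 1 + (c + 1) ∧ m + 1 ≤ L + (c + 1)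
    · rw [if_pos G, if_pos (by omega), ballotSum_succ _ (by omega)]
      rcases Nat.lt_or_ge j c with hjc | hjc
      · simp [ballotSum_of_lt _ hjc]
      obtain ⟨k, rfl⟩ := Nat.exists_eq_add_of_le hjc
      rcases Nat.lt_or_ge (c + 1) L with h | h
      · rw [if_pos (by omega), if_pos h, if_pos (by omega)]
        obtain ⟨s, rfl⟩ : ∃ s, L = c + s + 2 := ⟨L - c - 2, by omega⟩
        rw [show c + s + 2 - 1 = c + s + 1 from rfl,
          show m - (c + s + 1) = m + 1 - (c + s + 2) by omega,
          show 1 + (c + s + 1) - (c + 1) = s + 1 by omega,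
          show 1 + (c + s + 2) - (c + 1) = s + 2 by omega,
          show 1 + (c + s + 2) - c = s + 3 by omega,
          show c + k + 1 - (c + 1) = k by omega]
        have e1 : χ (-1) ^ ((m + 1 - (c + s + 2)) * (s + 1) + k) =
            χ (-1) ^ ((m + 1 - (c + s + 2)) * (s + 2) + k) * χ (-1) ^ (m + 1 - (c + s + 2)) := by
          rw [← pow_add]
          exact parity (x := m + 1 - (c + s + 2)) (y := 0) (by ring)
        have e2 : χ (-1) ^ (m - (c + k)) * χ (-1) ^ ((m - (c + s + 2)) * (s + 3)) *
              ballotSum (χ (-1)) m (c + s + 2) =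
            χ (-1) ^ ((m + 1 - (c + s + 2)) * (s + 2) + k) *
              ballotSum (χ (-1)) m (c + s + 2) := by
          rcases Nat.lt_or_ge m (c + s + 2) with hm | hm
          · rw [ballotSum_of_lt _ hm, mul_zero, mul_zero]
          · obtain ⟨b, rfl⟩ := Nat.exists_eq_add_of_le hm
            obtain ⟨p, hp⟩ : ∃ p, p = c + s + 2 + b - (c + k) := ⟨_, rfl⟩
            have hp' : p + k = b + s + 2 := by omega
            rw [← hp, Nat.add_sub_cancel_left,
              show c + s + 2 + b + 1 - (c + s + 2) = b + 1 by omega, ← pow_add]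
            congr 1
            refine parity (x := k) (y := b) ?_
            rw [show p + b * (s + 3) + 2 * k = p + k + (b * (s + 3) + k) by ring, hp']
            ring
        linear_combination ballotSum (χ (-1)) m (c + s + 1) * ballotSum (χ (-1)) (c + k) c * e1 +
          ballotSum (χ (-1)) (c + k) c * e2
      · obtain rfl : L = c + 1 := by omega
        have hif : (if c ≤ c ∧ c + (c + k) ≤ m + c ∧ m ≤ c + c then
              χ (-1) ^ ((m - c) * 1) * ballotSum (χ (-1)) m c *
                ballotSum (χ (-1)) (c + k) c else 0) =
            χ (-1) ^ (m - c) * ballotSum (χ (-1)) m c * ballotSum (χ (-1)) (c + k) c := by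
          split_ifs with h'
          · rw [mul_one]
          · rw [ballotSum_of_two_mul_lt _ (by omega : 2 * c < m)]
            ring
        rw [if_neg (by omega), if_neg (by omega), if_pos rfl, hif, if_pos (by omega)]
        obtain ⟨p, rfl⟩ : ∃ p, m = c + k + 1 + p := ⟨m - (c + k + 1), by omega⟩
        rw [show c + k + 1 + p - (c + k) = p + 1 by omega,
          show c + k + 1 + p - c = k + p + 1 by omega,
          show c + k + 1 + p - (c + 1) = k + p by omega,
          show c + k + 1 + p + 1 - (c + 1) = k + p + 1 by omega,
          show 1 + (c + 1) - c = 2 by omega, Nat.add_sub_cancel,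
          show c + k + 1 - (c + 1) = k by omega, Nat.add_sub_cancel, mul_one]
        have e1 : χ (-1) ^ (p + 1) * χ (-1) ^ (k + p + 1) =
            χ (-1) ^ (k + p + 1 + k) * χ (-1) ^ (k + p + 1) := by
          rw [← pow_add, ← pow_add]
          exact parity (x := k) (y := 0) (by ring)
        have e2 : χ (-1) ^ (p + 1) * χ (-1) ^ ((k + p) * 2) = χ (-1) ^ (k + p + 1 + k) := by
          rw [← pow_add]
          exact parity (x := 0) (y := p) (by ring)
        linear_combination
          ballotSum (χ (-1)) (c + k + 1 + p) c * ballotSum (χ (-1)) (c + k) c * e1 +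
          ballotSum (χ (-1)) (c + k + 1 + p) (c + 1) * ballotSum (χ (-1)) (c + k) c * e2
    · rw [if_neg G]
      split_ifs <;> omega

end weightedSums

lemma exactSum_eq_add_exactSum_two_mul {n : ℕ} (hn : 1 ≤ n) (j c L : ℕ) :
    exactSum 1 n j c L = exactSum (Units.coeHom ℤ) (2 * n) (2 * j) (2 * c) (2 * L) +
      exactSum (Units.coeHom ℤ) (2 * n) (2 * j) (2 * c) (2 * L + 1) := by
  rcases j with _ | j
  · rw [mul_zero, exactSum_at_zero, exactSum_at_zero, exactSum_at_zero]
    split_ifs <;> omega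
  obtain ⟨n, rfl⟩ : ∃ m, n = m + 1 := ⟨n - 1, by omega⟩
  rw [show 2 * (j + 1) = 2 * j + 1 + 1 by ring, exactSum_eq, exactSum_eq, exactSum_eq]
  by_cases G : 1 ≤ c ∧ c ≤ L ∧ L + j + 2 ≤ n + 1 + c ∧ n + 1 ≤ L + c
  · rw [if_pos G, if_pos (by omega), if_pos (by omega)]
    obtain ⟨c, rfl⟩ : ∃ d, c = d + 1 := ⟨c - 1, by omega⟩
    obtain ⟨L, rfl⟩ : ∃ d, L = d + 1 := ⟨L - 1, by omega⟩
    have hχ : Units.coeHom ℤ (-1) = -1 := rfl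
    have h1 : Even ((2 * (n + 1) - 2 * (L + 1)) * (1 + 2 * (L + 1) - 2 * (c + 1)) +
        (2 * j + 1 + 1 - 2 * (c + 1))) := by
      rw [← Nat.mul_sub, show 2 * j + 1 + 1 - 2 * (c + 1) = 2 * (j - c) by omega]
      exact ((even_two_mul _).mul_right _).add (even_two_mul _)
    have h2 : Even ((2 * (n + 1) - (2 * (L + 1) + 1)) * (1 + (2 * (L + 1) + 1) - 2 * (c + 1)) +
        (2 * j + 1 + 1 - 2 * (c + 1))) := by
      rw [show 1 + (2 * (L + 1) + 1) - 2 * (c + 1) = 2 * (L + 1 - c) by omega,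
        show 2 * j + 1 + 1 - 2 * (c + 1) = 2 * (j - c) by omega]
      exact ((even_two_mul _).mul_left _).add (even_two_mul _)
    rw [hχ, h1.neg_one_pow, h2.neg_one_pow, ballotSum_succ _ (by omega), Nat.add_sub_cancel,
      Nat.add_sub_cancel, show 2 * (c + 1) - 1 = 2 * c + 1 by omega, (ballotSum_neg_one j).1,
      mul_add 2 n 1, mul_one, show 2 * (L + 1) = 2 * L + 2 by ring, ballotSum_neg_one_even,
      show 2 * L + 2 + 1 = 2 * (L + 1) + 1 by ring, ballotSum_neg_one_odd]
    simp only [MonoidHom.one_apply, one_pow]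
    ring
  · rw [if_neg G, if_neg (by omega), if_neg (by omega), add_zero]

lemma exactSum_two_mul_odd (n j c L : ℕ) :
    exactSum (Units.coeHom ℤ) (2 * n) (2 * j) (2 * c + 1) L = 0 := by
  rcases j with _ | j
  · rw [mul_zero, exactSum_at_zero, if_neg (by omega)]
  · rw [show 2 * (j + 1) = 2 * j + 1 + 1 by ring, exactSum_eq, Nat.add_sub_cancel,
      show Units.coeHom ℤ (-1) = -1 from rfl, (ballotSum_neg_one j).2, mul_zero, ite_self]

/-- The `χ ∘ sign`-weighted number of 321-avoiding permutations of `Fin m` with last descent `j`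
and longest increasing subsequence of length `L`. -/
noncomputable def totalSum (χ : ℤˣ →* ℤ) (m j L : ℕ) : ℤ :=
  ∑ π : Equiv.Perm (Fin m),
    if Avoids321 π ∧ ldes π = j ∧ lis π = L then χ (Equiv.Perm.sign π) else 0

lemma lis_le {m : ℕ} (π : Equiv.Perm (Fin m)) : lis π ≤ m := by
  refine csSup_le' ?_
  rintro k ⟨s, -, rfl⟩
  simpa using s.card_le_univ

lemma totalSum_eq_sum_exactSum (χ : ℤˣ →* ℤ) {m N : ℕ} (h : m < N) (j L : ℕ) :
    totalSum χ m j L = ∑ c ∈ Finset.range N, exactSum χ m j c L := by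
  simp only [totalSum, exactSum]
  rw [Finset.sum_comm]
  refine Finset.sum_congr rfl fun π _ => ?_
  by_cases hπ : Avoids321 π ∧ ldes π = j ∧ lis π = L
  · have hc : prefixLis π j < N := by
      have h1 : prefixLis π j ≤ prefixLis π m := prefixLis_mono π (hπ.2.1 ▸ ldes_le π)
      rw [← lis_eq_prefixLis] at h1
      exact (h1.trans (lis_le π)).trans_lt h
    rw [if_pos hπ, Finset.sum_eq_single_of_mem _ (Finset.mem_range.mpr hc)
      fun c _ hne => if_neg fun h' => hne h'.2.2.1.symm, if_pos ⟨hπ.1, hπ.2.1, rfl, hπ.2.2⟩]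
  · rw [if_neg hπ]
    exact (Finset.sum_eq_zero fun c _ => if_neg fun h' => hπ ⟨h'.1, h'.2.1, h'.2.2.2⟩).symm

lemma sum_range_two_mul {M : Type*} [AddCommMonoid M] (f : ℕ → M) (N : ℕ) :
    ∑ c ∈ Finset.range (2 * N), f c = ∑ c ∈ Finset.range N, (f (2 * c) + f (2 * c + 1)) := by
  induction N with
  | zero => simp
  | succ N ih =>
    rw [mul_add, mul_one, Finset.sum_range_succ, Finset.sum_range_succ, ih,
      Finset.sum_range_succ, add_assoc]

lemma totalSum_eq_add_totalSum_two_mul {n : ℕ} (hn : 1 ≤ n) (j L : ℕ) :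
    totalSum 1 n j L = totalSum (Units.coeHom ℤ) (2 * n) (2 * j) (2 * L) +
      totalSum (Units.coeHom ℤ) (2 * n) (2 * j) (2 * L + 1) := by
  rw [totalSum_eq_sum_exactSum _ (Nat.lt_succ_self n),
    totalSum_eq_sum_exactSum _ (show 2 * n < 2 * (n + 1) by omega),
    totalSum_eq_sum_exactSum _ (show 2 * n < 2 * (n + 1) by omega),
    sum_range_two_mul, sum_range_two_mul, ← Finset.sum_add_distrib]
  simp only [exactSum_eq_add_exactSum_two_mul hn, exactSum_two_mul_odd, add_zero]

lemma sum_eq_sum_totalSum (χ : ℤˣ →* ℤ) {m M N : ℕ} (hM : m < M) (hN : m < N)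
    (f : ℕ → ℕ → MvPolynomial (Fin 2) ℤ) :
    (∑ π : Equiv.Perm (Fin m),
      if Avoids321 π then C (χ (Equiv.Perm.sign π)) * f (ldes π) (lis π) else 0) =
    ∑ j ∈ Finset.range M, ∑ L ∈ Finset.range N, C (totalSum χ m j L) * f j L := by
  simp only [totalSum, map_sum, Finset.sum_mul]
  simp_rw [Finset.sum_comm (s := Finset.range N) (t := Finset.univ)]
  rw [Finset.sum_comm]
  refine Finset.sum_congr rfl fun π _ => ?_
  have hj : ldes π ∈ Finset.range M := Finset.mem_range.mpr ((ldes_le π).trans_lt hM)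
  have hL : lis π ∈ Finset.range N := Finset.mem_range.mpr ((lis_le π).trans_lt hN)
  rw [Finset.sum_eq_single_of_mem _ hj, Finset.sum_eq_single_of_mem _ hL]
  · by_cases ha : Avoids321 π <;> simp [ha]
  · intro L _ hne
    rw [if_neg fun h => hne h.2.2.symm, map_zero, zero_mul]
  · intro j _ hne
    refine Finset.sum_eq_zero fun L _ => ?_
    rw [if_neg fun h => hne h.2.1.symm, map_zero, zero_mul]

end SignBalance

theorem refined_sign_balance_even (n : ℕ) (hn : 1 ≤ n) :
    ∑ π ∈ Finset.univ.filter (fun π : Equiv.Perm (Fin n) => Avoids321 π),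
        (X 0 : MvPolynomial (Fin 2) ℤ) ^ (2 * lis π + 1) * X 1 ^ (2 * ldes π)
      =
    (∑ π ∈ Finset.univ.filter (fun π : Equiv.Perm (Fin (2 * n)) =>
          Avoids321 π ∧ Even (ldes π) ∧ Odd (lis π)),
        C ((Equiv.Perm.sign π : ℤ)) * X 0 ^ lis π * X 1 ^ ldes π)
      +
    (X 0 : MvPolynomial (Fin 2) ℤ) *
      ∑ π ∈ Finset.univ.filter (fun π : Equiv.Perm (Fin (2 * n)) =>
          Avoids321 π ∧ Even (ldes π) ∧ Even (lis π)),
        C ((Equiv.Perm.sign π : ℤ)) * X 0 ^ lis π * X 1 ^ ldes π := by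
  have hl : ∑ π ∈ Finset.univ.filter (fun π : Equiv.Perm (Fin n) => Avoids321 π),
      (X 0 : MvPolynomial (Fin 2) ℤ) ^ (2 * lis π + 1) * X 1 ^ (2 * ldes π) =
      ∑ π : Equiv.Perm (Fin n), if Avoids321 π then
        C ((1 : ℤˣ →* ℤ) (Equiv.Perm.sign π)) *
          ((X 0 : MvPolynomial (Fin 2) ℤ) ^ (2 * lis π + 1) * X 1 ^ (2 * ldes π)) else 0 := by
    simp only [Finset.sum_filter, MonoidHom.one_apply, map_one, one_mul]
  have hr : (∑ π ∈ Finset.univ.filter (fun π : Equiv.Perm (Fin (2 * n)) =>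
          Avoids321 π ∧ Even (ldes π) ∧ Odd (lis π)),
        C ((Equiv.Perm.sign π : ℤ)) * X 0 ^ lis π * X 1 ^ ldes π) +
      (X 0 : MvPolynomial (Fin 2) ℤ) *
      ∑ π ∈ Finset.univ.filter (fun π : Equiv.Perm (Fin (2 * n)) =>
          Avoids321 π ∧ Even (ldes π) ∧ Even (lis π)),
        C ((Equiv.Perm.sign π : ℤ)) * X 0 ^ lis π * X 1 ^ ldes π =
      ∑ π : Equiv.Perm (Fin (2 * n)), if Avoids321 π then
        C (Units.coeHom ℤ (Equiv.Perm.sign π)) *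
          (if Even (ldes π) then
            (X 0 : MvPolynomial (Fin 2) ℤ) ^ (if Even (lis π) then lis π + 1 else lis π) *
              X 1 ^ ldes π else 0) else 0 := by
    rw [Finset.mul_sum, Finset.sum_filter, Finset.sum_filter, ← Finset.sum_add_distrib]
    refine Finset.sum_congr rfl fun π _ => ?_
    simp only [Units.coeHom_apply, ← Nat.not_even_iff_odd]
    by_cases h1 : Avoids321 π <;> by_cases h2 : Even (ldes π) <;>
      by_cases h3 : Even (lis π) <;> simp [h1, h2, h3] <;> ring
  rw [hl, hr, SignBalance.sum_eq_sum_totalSum 1 n.lt_succ_self n.lt_succ_self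
      fun j L => X 0 ^ (2 * L + 1) * X 1 ^ (2 * j),
    SignBalance.sum_eq_sum_totalSum (Units.coeHom ℤ) (show 2 * n < 2 * (n + 1) by omega)
      (show 2 * n < 2 * (n + 1) by omega)
      fun j L => if Even j then X 0 ^ (if Even L then L + 1 else L) * X 1 ^ j else 0,
    SignBalance.sum_range_two_mul]
  refine Finset.sum_congr rfl fun j _ => ?_
  simp only [SignBalance.sum_range_two_mul, even_two_mul, Nat.not_even_two_mul_add_one, if_true,
    if_false, mul_zero, add_zero, Finset.sum_const_zero,
    SignBalance.totalSum_eq_add_totalSum_two_mul hn, map_add, add_mul]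
end

section
/- For all n ≥ 1 and every d, the number of 321-avoiding permutations π of {1,…,n} with ldes(π) = d equals the number of 321-avoiding permutations π of {1,…,n} with π⁻¹(n) − 1 = d. In other words, the statistics ldes and lind − 1 are equidistributed over T_n, where lind(π) = π⁻¹(n) is the position of the letter n in π. -/
open scoped Classical


theorem Avoids321.lt_or_lt {n : ℕ} {π : Equiv.Perm (Fin n)} (h : Avoids321 π)
    {i j k : Fin n} (hij : i < j) (hjk : j < k) : π i < π j ∨ π j < π k := by
  by_contra hc
  rw [not_or, not_lt, not_lt] at hc
  exact h ⟨i, j, k, hij, hjk, lt_of_le_of_ne hc.2 (π.injective.ne hjk.ne'),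
    lt_of_le_of_ne hc.1 (π.injective.ne hij.ne')⟩

theorem ldes_le_iff {n : ℕ} (π : Equiv.Perm (Fin n)) (d : ℕ) :
    ldes π ≤ d ↔ ∀ i j : Fin n, d ≤ i → i < j → π i < π j := by
  have hbdd : BddAbove {d : ℕ | 1 ≤ d ∧ ∃ h : d < n, π ⟨d, h⟩ < π ⟨d - 1, by omega⟩} :=
    ⟨n, fun e he => he.2.1.le⟩
  constructor
  · intro h
    have step : ∀ k, d ≤ k → ∀ hk : k + 1 < n, π ⟨k, by omega⟩ < π ⟨k + 1, hk⟩ := by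
      intro k hdk hk
      by_contra hc
      have hne : π ⟨k + 1, hk⟩ ≠ π ⟨k, by omega⟩ := π.injective.ne (by simp)
      have : k + 1 ≤ ldes π :=
        le_csSup hbdd ⟨by omega, hk, lt_of_le_of_ne (not_lt.1 hc) hne⟩
      omega
    rintro ⟨i, hin⟩ ⟨j, hjn⟩ hi hij
    simp only [Fin.mk_lt_mk] at hi hij
    induction j, hij using Nat.le_induction with
    | base => exact step i hi hjn
    | succ j hj ih => exact (ih (by omega)).trans (step j (by omega) hjn)
  · intro h
    refine csSup_le' ?_
    rintro e ⟨he, hen, hlt⟩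
    by_contra hc
    refine absurd hlt (h ⟨e - 1, by omega⟩ ⟨e, hen⟩ ?_ ?_).asymm
    · simp only
      omega
    · simp only [Fin.mk_lt_mk]
      omega

/-- Insert a new largest letter into `σ` at position `p`. -/
noncomputable def insertMax {m : ℕ} (p : Fin (m + 1)) (σ : Equiv.Perm (Fin m)) :
    Equiv.Perm (Fin (m + 1)) :=
  (finSuccEquiv' p).trans (σ.optionCongr.trans (finSuccEquiv' (Fin.last m)).symm)

@[simp]
theorem insertMax_self {m : ℕ} (p : Fin (m + 1)) (σ : Equiv.Perm (Fin m)) :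
    insertMax p σ p = Fin.last m := by
  simp [insertMax]

@[simp]
theorem insertMax_succAbove {m : ℕ} (p : Fin (m + 1)) (σ : Equiv.Perm (Fin m)) (i : Fin m) :
    insertMax p σ (p.succAbove i) = (σ i).castSucc := by
  simp [insertMax]

@[simp]
theorem insertMax_symm_last {m : ℕ} (p : Fin (m + 1)) (σ : Equiv.Perm (Fin m)) :
    (insertMax p σ).symm (Fin.last m) = p := by
  rw [Equiv.symm_apply_eq, insertMax_self]

theorem insertMax_left_injective {m : ℕ} {p q : Fin (m + 1)} {σ τ : Equiv.Perm (Fin m)}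
    (h : insertMax p σ = insertMax q τ) : p = q := by
  rw [← insertMax_symm_last p σ, h, insertMax_symm_last]

theorem insertMax_right_injective {m : ℕ} {p q : Fin (m + 1)} {σ τ : Equiv.Perm (Fin m)}
    (h : insertMax p σ = insertMax q τ) : σ = τ := by
  obtain rfl := insertMax_left_injective h
  ext i
  have := congrArg Fin.val (Equiv.congr_fun h (p.succAbove i))
  simpa using this

theorem exists_insertMax {m : ℕ} (π : Equiv.Perm (Fin (m + 1))) :
    ∃ p σ, insertMax p σ = π := by
  set p := π.symm (Fin.last m) with hp
  have hπp : π p = Fin.last m := by simp [hp]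
  let e : Option (Fin m) ≃ Option (Fin m) :=
    (finSuccEquiv' p).symm.trans (π.trans (finSuccEquiv' (Fin.last m)))
  have hnone : e none = none := by simp [e, hπp]
  have hsome (i : Fin m) : some (e.removeNone i) = e (some i) := by
    refine Equiv.removeNone_some e (Option.ne_none_iff_exists'.1 fun h => ?_)
    exact Option.some_ne_none i (e.injective (h.trans hnone.symm))
  refine ⟨p, e.removeNone, Equiv.ext fun j => ?_⟩
  obtain rfl | ⟨i, rfl⟩ := p.eq_self_or_eq_succAbove j
  · rw [insertMax_self, hπp]
  · have h := congrArg (finSuccEquiv' (Fin.last m)).symm (hsome i)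
    simpa [e] using h

theorem le_val_of_lt_succAbove {m : ℕ} {p : Fin (m + 1)} {i : Fin m} (h : p < p.succAbove i) :
    (p : ℕ) ≤ i := by
  rwa [Fin.lt_succAbove_iff_le_castSucc, Fin.le_def] at h

theorem avoids321_insertMax_iff {m : ℕ} (p : Fin (m + 1)) (σ : Equiv.Perm (Fin m)) :
    Avoids321 (insertMax p σ) ↔ Avoids321 σ ∧ ldes σ ≤ p := by
  constructor
  · intro h
    constructor
    · rintro ⟨i, j, k, hij, hjk, h1, h2⟩
      exact h ⟨p.succAbove i, p.succAbove j, p.succAbove k, by simpa, by simpa,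
        by simpa, by simpa⟩
    · rw [ldes_le_iff]
      intro i j hi hij
      have hpi : p < p.succAbove i := by
        rwa [Fin.lt_succAbove_iff_le_castSucc, Fin.le_def]
      have := h.lt_or_lt hpi (Fin.succAbove_lt_succAbove_iff.2 hij)
      simpa [(Fin.castSucc_lt_last _).not_gt] using this
  · rintro ⟨h, hd⟩ ⟨i, j, k, hij, hjk, h1, h2⟩
    rw [ldes_le_iff] at hd
    obtain rfl | ⟨k, rfl⟩ := p.eq_self_or_eq_succAbove k
    · simp [(Fin.le_last _).not_gt] at h1
    obtain rfl | ⟨j, rfl⟩ := p.eq_self_or_eq_succAbove j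
    · simp [(Fin.le_last _).not_gt] at h2
    rw [Fin.succAbove_lt_succAbove_iff] at hjk
    simp only [insertMax_succAbove, Fin.castSucc_lt_castSucc_iff] at h1
    obtain rfl | ⟨i, rfl⟩ := p.eq_self_or_eq_succAbove i
    · exact h1.asymm (hd j k (le_val_of_lt_succAbove hij) hjk)
    · rw [Fin.succAbove_lt_succAbove_iff] at hij
      simp only [insertMax_succAbove, Fin.castSucc_lt_castSucc_iff] at h2
      exact h ⟨i, j, k, hij, hjk, h1, h2⟩

theorem ldes_le {m : ℕ} (π : Equiv.Perm (Fin (m + 1))) : ldes π ≤ m := by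
  rw [ldes_le_iff]
  intro i j hi hij
  omega

theorem ldes_insertMax_last {m : ℕ} (σ : Equiv.Perm (Fin m)) :
    ldes (insertMax (Fin.last m) σ) = ldes σ := by
  have hc (i : Fin m) : insertMax (Fin.last m) σ i.castSucc = (σ i).castSucc := by
    rw [← Fin.succAbove_last_apply, insertMax_succAbove]
  refine eq_of_forall_ge_iff fun d => ?_
  rw [ldes_le_iff, ldes_le_iff]
  constructor
  · intro h i j hi hij
    simpa [hc] using h i.castSucc j.castSucc hi hij
  · intro h i j hi hij
    obtain ⟨i, rfl⟩ := Fin.exists_castSucc_eq.2 (hij.trans_le (Fin.le_last j)).ne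
    induction j using Fin.lastCases with
    | last => simp [hc, Fin.castSucc_lt_last]
    | cast j => simpa [hc] using h i j hi hij

theorem ldes_insertMax_of_ne_last {m : ℕ} {p : Fin (m + 1)} {σ : Equiv.Perm (Fin m)}
    (hp : p ≠ Fin.last m) (hσ : ldes σ ≤ p) : ldes (insertMax p σ) = p + 1 := by
  rw [ldes_le_iff] at hσ
  apply le_antisymm
  · rw [ldes_le_iff]
    intro i j hi hij
    have hpi : p < i := hi
    obtain rfl | ⟨i, rfl⟩ := p.eq_self_or_eq_succAbove i
    · exact absurd hpi (lt_irrefl _)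
    obtain rfl | ⟨j, rfl⟩ := p.eq_self_or_eq_succAbove j
    · exact absurd hpi hij.asymm
    rw [Fin.succAbove_lt_succAbove_iff] at hij
    simpa using hσ i j (le_val_of_lt_succAbove hpi) hij
  · by_contra hc
    have hle : ldes (insertMax p σ) ≤ p := by omega
    rw [ldes_le_iff] at hle
    have := hle p (Fin.last m) le_rfl (Fin.lt_last_iff_ne_last.2 hp)
    rw [insertMax_self] at this
    exact absurd this (Fin.le_last _).not_gt

/-- Removing the largest letter from a 321-avoiding permutation having it at (0-based) position
`d` gives an arbitrary 321-avoiding permutation with largest descent at most `d`. -/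
theorem card_symm_last_eq {m d : ℕ} (hd : d ≤ m) :
    Nat.card {σ : Equiv.Perm (Fin m) // Avoids321 σ ∧ ldes σ ≤ d} =
    Nat.card {π : Equiv.Perm (Fin (m + 1)) // Avoids321 π ∧
      ((π.symm (Fin.last m) : Fin (m + 1)) : ℕ) = d} := by
  refine Nat.card_eq_of_bijective (fun σ => ⟨insertMax ⟨d, by omega⟩ σ.1,
    (avoids321_insertMax_iff _ _).2 σ.2, by simp⟩) ⟨?_, ?_⟩
  · intro σ τ h
    exact Subtype.ext (insertMax_right_injective (congrArg Subtype.val h))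
  · rintro ⟨π, hπ, hlast⟩
    obtain ⟨p, σ, rfl⟩ := exists_insertMax π
    rw [insertMax_symm_last] at hlast
    subst hlast
    exact ⟨⟨σ, (avoids321_insertMax_iff _ _).1 hπ⟩, rfl⟩

/-- Removing the largest letter from a 321-avoiding permutation with largest descent `d` gives an
arbitrary 321-avoiding permutation with largest descent at most `d`; that letter was at the end
if the largest descent is still `d`, and at (0-based) position `d - 1` otherwise. -/
theorem card_ldes_eq {m d : ℕ} (hd : d ≤ m) :
    Nat.card {π : Equiv.Perm (Fin (m + 1)) // Avoids321 π ∧ ldes π = d} =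
    Nat.card {σ : Equiv.Perm (Fin m) // Avoids321 σ ∧ ldes σ ≤ d} := by
  have key (p : Fin (m + 1)) (σ : Equiv.Perm (Fin m)) :
      (Avoids321 (insertMax p σ) ∧ ldes (insertMax p σ) = d) ↔
      (Avoids321 σ ∧ ldes σ ≤ d) ∧ (p : ℕ) = if ldes σ = d then m else d - 1 := by
    rw [avoids321_insertMax_iff]
    by_cases hp : p = Fin.last m
    · subst hp
      rw [ldes_insertMax_last, Fin.val_last]
      split_ifs <;> grind
    · have hlt : (p : ℕ) < m := Fin.val_lt_last hp
      constructor
      · rintro ⟨⟨h1, h2⟩, h3⟩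
        rw [ldes_insertMax_of_ne_last hp h2] at h3
        grind
      · rintro ⟨⟨h1, h2⟩, h3⟩
        split_ifs at h3 with h
        · omega
        · have h4 : ldes σ ≤ p := by omega
          rw [ldes_insertMax_of_ne_last hp h4]
          exact ⟨⟨h1, h4⟩, by omega⟩
  symm
  refine Nat.card_eq_of_bijective (fun σ => ⟨insertMax
    ⟨if ldes σ.1 = d then m else d - 1, by split_ifs <;> omega⟩ σ.1,
    (key _ _).2 ⟨σ.2, rfl⟩⟩) ⟨?_, ?_⟩
  · intro σ τ h
    exact Subtype.ext (insertMax_right_injective (congrArg Subtype.val h))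
  · rintro ⟨π, hπ⟩
    obtain ⟨p, σ, rfl⟩ := exists_insertMax π
    obtain ⟨hσ, hp⟩ := (key p σ).1 hπ
    exact ⟨⟨σ, hσ⟩, Subtype.ext (congrArg (insertMax · σ) (Fin.ext hp.symm))⟩

/-- `ldes` and `lind − 1` are equidistributed over `T_n`, where `lind π = π⁻¹(n)`
is the (1-based) position of the letter `n` in `π`. -/
theorem ldes_lind_equidistributed (n : ℕ) (hn : 1 ≤ n) (d : ℕ) :
    Nat.card {π : Equiv.Perm (Fin n) // Avoids321 π ∧ ldes π = d}
      =
    Nat.card {π : Equiv.Perm (Fin n) // Avoids321 π ∧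
      ((π.symm ⟨n - 1, by omega⟩ : Fin n) : ℕ) + 1 - 1 = d} := by
  obtain ⟨m, rfl⟩ : ∃ m, n = m + 1 := ⟨n - 1, by omega⟩
  rcases le_or_gt d m with hd | hd
  · exact (card_ldes_eq hd).trans (card_symm_last_eq hd)
  · have h1 : IsEmpty {π : Equiv.Perm (Fin (m + 1)) // Avoids321 π ∧ ldes π = d} :=
      ⟨fun π => by have := ldes_le π.1; have := π.2.2; omega⟩
    have h2 : IsEmpty {π : Equiv.Perm (Fin (m + 1)) // Avoids321 π ∧
        ((π.symm ⟨m + 1 - 1, by omega⟩ : Fin (m + 1)) : ℕ) + 1 - 1 = d} :=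
      ⟨fun π => by have := π.2.2; omega⟩
    rw [Nat.card_of_isEmpty, Nat.card_of_isEmpty]
end

section
/- For all n ≥ 1, every subset B ⊆ {1,…,n−2}, and every d, the number of 321-avoiding permutations π of {1,…,n} with D(π⁻¹) ∩ {1,…,n−2} = B and ldes(π) = d equals the number of 321-avoiding permutations π of {1,…,n} with D(π⁻¹) ∩ {1,…,n−2} = B and π⁻¹(n) − 1 = d. That is, ldes and lind − 1 are equidistributed over the set {π ∈ T_n : D(π⁻¹) ∩ {1,…,n−2} = B}. -/
open scoped Classical


/-- The (1-based) descent set of a permutation, as a set of natural numbers. -/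
def descentSet {n : ℕ} (π : Equiv.Perm (Fin n)) : Set ℕ :=
  {i : ℕ | 1 ≤ i ∧ ∃ h : i < n, π ⟨i, h⟩ < π ⟨i - 1, by omega⟩}

/-- Insert a new largest letter into `τ` at the (0-based) position `q`. -/
def insertLargest {m : ℕ} (q : Fin (m + 1)) (τ : Equiv.Perm (Fin m)) :
    Equiv.Perm (Fin (m + 1)) :=
  (finSuccEquiv' q).trans ((Equiv.optionCongr τ).trans (finSuccEquiv' (Fin.last m)).symm)

section insertLargest

variable {m : ℕ} (q : Fin (m + 1)) (τ : Equiv.Perm (Fin m))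

@[simp]
theorem insertLargest_self : insertLargest q τ q = Fin.last m := by
  simp [insertLargest]

@[simp]
theorem insertLargest_succAbove (i : Fin m) :
    insertLargest q τ (q.succAbove i) = (τ i).castSucc := by
  simp [insertLargest]

@[simp]
theorem insertLargest_symm_last : (insertLargest q τ).symm (Fin.last m) = q := by
  simp [Equiv.symm_apply_eq]

@[simp]
theorem insertLargest_symm_castSucc (i : Fin m) :
    (insertLargest q τ).symm i.castSucc = q.succAbove (τ.symm i) := by
  simp [Equiv.symm_apply_eq]

theorem insertLargest_bijective :
    Function.Bijective fun p : Fin (m + 1) × Equiv.Perm (Fin m) => insertLargest p.1 p.2 := by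
  rw [Fintype.bijective_iff_injective_and_card]
  constructor
  · rintro ⟨q, τ⟩ ⟨q', τ'⟩ h
    have h' : insertLargest q τ = insertLargest q' τ' := h
    have hq : q = q' := by
      rw [← insertLargest_symm_last q τ, h', insertLargest_symm_last]
    subst hq
    refine Prod.ext rfl (Equiv.ext fun i => ?_)
    have := congrArg (fun π => π (q.succAbove i)) h'
    simpa using this
  · simp [Fintype.card_perm, Nat.factorial_succ]

theorem succAbove_eq_succ {q : Fin (m + 1)} {i : Fin m} (h : (q : ℕ) ≤ i) :
    q.succAbove i = i.succ :=
  Fin.succAbove_of_le_castSucc _ _ h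

theorem exists_succ_of_lt {q i : Fin (m + 1)} (h : q < i) :
    ∃ i' : Fin m, (q : ℕ) ≤ i' ∧ (i : ℕ) = i' + 1 ∧ q.succAbove i' = i := by
  have hlt : (q : ℕ) < i := h
  have hi := i.2
  refine ⟨⟨i - 1, by omega⟩, by simp; omega, by simp; omega, ?_⟩
  rw [succAbove_eq_succ (by simp; omega)]
  ext
  simp
  omega

theorem avoids321_insertLargest_iff :
    Avoids321 (insertLargest q τ) ↔ Avoids321 τ ∧ ldes τ ≤ q := by
  constructor
  · intro h
    constructor
    · rintro ⟨i, j, k, hij, hjk, hkj, hji⟩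
      exact h ⟨q.succAbove i, q.succAbove j, q.succAbove k, by simpa, by simpa, by simpa,
        by simpa⟩
    · rw [ldes_le_iff]
      intro i j hi hij
      by_contra hlt
      have hne : τ i ≠ τ j := by simpa using hij.ne
      have hlt' : τ j < τ i := lt_of_le_of_ne (not_lt.1 hlt) hne.symm
      refine h ⟨q, q.succAbove i, q.succAbove j, ?_, by simpa, by simpa, ?_⟩
      · rw [succAbove_eq_succ hi, Fin.lt_def, Fin.val_succ]
        omega
      · simp [Fin.castSucc_lt_last]
  · rintro ⟨h, hd⟩ ⟨i, j, k, hij, hjk, hkj, hji⟩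
    rw [ldes_le_iff] at hd
    have hjq : j ≠ q := by
      rintro rfl
      rw [insertLargest_self] at hji
      exact absurd (Fin.le_last _) (not_le.2 hji)
    have hkq : k ≠ q := by
      rintro rfl
      rw [insertLargest_self] at hkj
      exact absurd (Fin.le_last _) (not_le.2 hkj)
    obtain ⟨j, rfl⟩ := Fin.exists_succAbove_eq hjq
    obtain ⟨k, rfl⟩ := Fin.exists_succAbove_eq hkq
    have hjk' : j < k := by simpa using hjk
    have hkj' : τ k < τ j := by simpa using hkj
    by_cases hiq : i = q
    · subst hiq
      obtain ⟨j', hj', -, hjj'⟩ := exists_succ_of_lt hij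
      obtain rfl := Fin.succAbove_right_injective hjj'
      exact lt_asymm hkj' (hd _ _ hj' hjk')
    · obtain ⟨i, rfl⟩ := Fin.exists_succAbove_eq hiq
      exact h ⟨i, j, k, by simpa using hij, hjk', hkj', by simpa using hji⟩

theorem descentSet_insertLargest_symm :
    descentSet (insertLargest q τ).symm ∩ Set.Icc 1 (m - 1) = descentSet τ.symm := by
  have key : ∀ (e : ℕ) (h : e < m), (insertLargest q τ).symm ⟨e, by omega⟩ =
      q.succAbove (τ.symm ⟨e, h⟩) := fun e h => insertLargest_symm_castSucc q τ ⟨e, h⟩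
  ext e
  constructor
  · rintro ⟨⟨h1, h2, hlt⟩, -, h4⟩
    rw [key e (by omega), key (e - 1) (by omega)] at hlt
    exact ⟨h1, by omega, by simpa using hlt⟩
  · rintro ⟨h1, h2, hlt⟩
    refine ⟨⟨h1, by omega, ?_⟩, h1, by omega⟩
    rw [key e (by omega), key (e - 1) (by omega)]
    simpa using hlt

theorem ldes_insertLargest {q : Fin (m + 1)} {τ : Equiv.Perm (Fin m)} (h : ldes τ ≤ q) :
    ldes (insertLargest q τ) = if (q : ℕ) = m then ldes τ else q + 1 := by
  refine eq_of_forall_ge_iff fun d => ?_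
  split_ifs with hq
  · obtain rfl : q = Fin.last m := Fin.ext hq
    have key : ∀ i : Fin m, insertLargest (Fin.last m) τ i.castSucc = (τ i).castSucc := by
      intro i
      simpa using insertLargest_succAbove (Fin.last m) τ i
    simp only [ldes_le_iff]
    constructor
    · intro H i j hi hij
      simpa [key] using H i.castSucc j.castSucc hi hij
    · intro H i j hi hij
      induction i using Fin.lastCases with
      | last => exact absurd (Fin.le_last j) (not_le.2 hij)
      | cast i =>
        induction j using Fin.lastCases with
        | last =>
          rw [key, insertLargest_self]
          exact Fin.castSucc_lt_last _
        | cast j =>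
          rw [key, key]
          exact H i j hi hij
  · rw [ldes_le_iff]
    rw [ldes_le_iff] at h
    have hq' := q.2
    constructor
    · intro H
      by_contra hd
      have := H q ⟨q + 1, by omega⟩ (by omega) (by simp [Fin.lt_def])
      rw [insertLargest_self] at this
      exact absurd (Fin.le_last _) (not_le.2 this)
    · intro H i j hi hij
      obtain ⟨i, hqi, -, rfl⟩ := exists_succ_of_lt (q := q) (i := i) (Fin.lt_def.2 (by omega))
      obtain ⟨j, -, -, rfl⟩ := exists_succ_of_lt (q := q) (i := j)
        ((Fin.lt_def.2 (by omega)).trans hij)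
      simpa using h i j hqi (by simpa using hij)

end insertLargest

theorem ldes_le_sub_one {m : ℕ} (τ : Equiv.Perm (Fin m)) : ldes τ ≤ m - 1 := by
  rw [ldes_le_iff]
  intro i j hi hij
  have := Fin.lt_def.1 hij
  omega

/-- Pairs of a position `q` and a permutation `τ`, counted by the last descent or by the position
of the largest letter of `insertLargest q τ`, are equinumerous. -/
theorem card_insertion_pairs {m : ℕ} (P : Equiv.Perm (Fin m) → Prop) (d : ℕ) :
    Nat.card {p : Fin (m + 1) × Equiv.Perm (Fin m) // P p.2 ∧ ldes p.2 ≤ p.1 ∧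
        (if (p.1 : ℕ) = m then ldes p.2 else p.1 + 1) = d}
      =
    Nat.card {p : Fin (m + 1) × Equiv.Perm (Fin m) // P p.2 ∧ ldes p.2 ≤ p.1 ∧
        (p.1 : ℕ) = d} := by
  refine Nat.card_eq_of_bijective (fun p => ⟨(⟨d, ?_⟩, p.1.2), p.2.1, ?_, rfl⟩) ⟨?_, ?_⟩
  · obtain ⟨⟨q, τ⟩, h1, h2, h3⟩ := p
    have := ldes_le_sub_one τ
    have := q.2
    grind
  · obtain ⟨⟨q, τ⟩, h1, h2, h3⟩ := p
    grind
  · rintro ⟨⟨q, τ⟩, h1, h2, h3⟩ ⟨⟨q', τ'⟩, h1', h2', h3'⟩ h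
    obtain rfl : τ = τ' := by simpa using h
    have : q = q' := Fin.ext (by dsimp only at *; grind)
    subst this
    rfl
  · rintro ⟨⟨q, τ⟩, h1, h2, h3⟩
    dsimp only at h1 h2 h3
    have hτ := ldes_le_sub_one τ
    have hq := q.2
    by_cases hd : d = ldes τ
    · exact ⟨⟨(Fin.last m, τ), h1, by simp; omega, by simp [hd]⟩,
        Subtype.ext (Prod.ext (Fin.ext h3.symm) rfl)⟩
    · exact ⟨⟨(⟨d - 1, by omega⟩, τ), h1, by simp; omega,
          (if_neg (by simp; omega)).trans (by simp; omega)⟩,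
        Subtype.ext (Prod.ext (Fin.ext h3.symm) rfl)⟩

/-- `ldes` and `lind − 1` are equidistributed over
`{π ∈ T_n : D(π⁻¹) ∩ [n−2] = B}` for every `B ⊆ [n−2]`. -/
theorem ldes_lind_equidistributed_refined (n : ℕ) (hn : 1 ≤ n) (B : Finset ℕ)
    (hB : ↑B ⊆ Set.Icc 1 (n - 2)) (d : ℕ) :
    Nat.card {π : Equiv.Perm (Fin n) // Avoids321 π ∧
        descentSet π.symm ∩ Set.Icc 1 (n - 2) = ↑B ∧ ldes π = d}
      =
    Nat.card {π : Equiv.Perm (Fin n) // Avoids321 π ∧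
        descentSet π.symm ∩ Set.Icc 1 (n - 2) = ↑B ∧
        ((π.symm ⟨n - 1, by omega⟩ : Fin n) : ℕ) + 1 - 1 = d} := by
  obtain ⟨m, rfl⟩ : ∃ m, n = m + 1 := ⟨n - 1, by omega⟩
  let E := Equiv.ofBijective _ (insertLargest_bijective (m := m))
  have hE : ∀ p, E p = insertLargest p.1 p.2 := fun _ => rfl
  have hlast : (⟨m + 1 - 1, by omega⟩ : Fin (m + 1)) = Fin.last m := rfl
  have hsub : m + 1 - 2 = m - 1 := by omega
  rw [← Nat.card_congr (E.subtypeEquiv (p := fun p => (Avoids321 p.2 ∧ descentSet p.2.symm = ↑B) ∧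
      ldes p.2 ≤ p.1 ∧ (if (p.1 : ℕ) = m then ldes p.2 else p.1 + 1) = d) ?_),
    ← Nat.card_congr (E.subtypeEquiv (p := fun p => (Avoids321 p.2 ∧ descentSet p.2.symm = ↑B) ∧
      ldes p.2 ≤ p.1 ∧ (p.1 : ℕ) = d) ?_)]
  · exact card_insertion_pairs (fun τ => Avoids321 τ ∧ descentSet τ.symm = ↑B) d
  · rintro ⟨q, τ⟩
    rw [hE, hlast, hsub, avoids321_insertLargest_iff, descentSet_insertLargest_symm,
      insertLargest_symm_last, Nat.add_sub_cancel]
    tauto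
  · rintro ⟨q, τ⟩
    rw [hE, hsub, avoids321_insertLargest_iff, descentSet_insertLargest_symm]
    constructor
    · rintro ⟨⟨h1, h2⟩, h3, h4⟩
      exact ⟨⟨h1, h3⟩, h2, (ldes_insertLargest h3).trans h4⟩
    · rintro ⟨⟨h1, h3⟩, h2, h4⟩
      exact ⟨⟨h1, h2⟩, h3, (ldes_insertLargest h3).symm.trans h4⟩
end

section
/- Let n, k, and d all be odd. Then the number of ballot sequences q of length n with exactly k entries equal to 1 satisfying ε(q) = 0 and δ(q) = d equals the number of ballot sequences q of length n with exactly k entries equal to 1 satisfying ε(q) = δ(q) − 1 and δ(q) = d. -/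
open scoped Classical

/-- A ballot sequence of length `n`: entries (indexed so that `b i` is the entry in
position `i+1`) are `±1` and all partial sums are nonnegative. -/
def IsBallot {n : ℕ} (b : Fin n → ℤ) : Prop :=
  (∀ i, b i = 1 ∨ b i = -1) ∧
  ∀ j : Fin n, 0 ≤ ∑ i ∈ Finset.univ.filter (fun i => i ≤ j), b i

/-- The number of entries equal to `1`. -/
def ones {n : ℕ} (b : Fin n → ℤ) : ℕ := (Finset.univ.filter (fun i => b i = 1)).card

/-- `eps b` is the smallest even (1-based) position `d` with `b_d = -b_{d+1}`,
and `0` if no such position exists. -/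
noncomputable def eps {n : ℕ} (b : Fin n → ℤ) : ℕ :=
  sInf {d : ℕ | Even d ∧ 1 ≤ d ∧ ∃ h : d < n, b ⟨d - 1, by omega⟩ = -b ⟨d, h⟩}

/-- `delta b` is the greatest (1-based) position `d` with `b_d = 1` and `b_{d+1} = -1`. -/
noncomputable def delta {n : ℕ} (b : Fin n → ℤ) : ℕ :=
  sSup {d : ℕ | 1 ≤ d ∧ ∃ h : d < n, b ⟨d - 1, by omega⟩ = 1 ∧ b ⟨d, h⟩ = -1}

/-- The extension of a finite sequence to `ℕ` by zero. -/
def extendZero {n : ℕ} (b : Fin n → ℤ) (i : ℕ) : ℤ := if h : i < n then b ⟨i, h⟩ else 0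

theorem extendZero_of_lt {n : ℕ} (b : Fin n → ℤ) {i : ℕ} (h : i < n) :
    extendZero b i = b ⟨i, h⟩ := dif_pos h

/-- Change the sign of the entries with (zero-based) indices `p` and `s`. -/
def flipAt {n : ℕ} (p s : ℕ) (b : Fin n → ℤ) : Fin n → ℤ :=
  fun i => if i.1 = p ∨ i.1 = s then -b i else b i

theorem flipAt_flipAt {n : ℕ} (p s : ℕ) (b : Fin n → ℤ) : flipAt p s (flipAt p s b) = b := by
  funext i
  unfold flipAt
  split_ifs <;> simp

theorem extendZero_flipAt {n : ℕ} (p s : ℕ) (b : Fin n → ℤ) (i : ℕ) :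
    extendZero (flipAt p s b) i =
      if i = p ∨ i = s then -extendZero b i else extendZero b i := by
  unfold extendZero flipAt
  split_ifs <;> simp_all

theorem sum_filter_le_eq_sum_range {n : ℕ} (b : Fin n → ℤ) (j : Fin n) :
    ∑ i ∈ Finset.univ.filter (fun i => i ≤ j), b i =
      ∑ i ∈ Finset.range (j.1 + 1), extendZero b i := by
  refine Finset.sum_bij (fun i _ => i.1) ?_ ?_ ?_ ?_
  · intro i hi
    have : i ≤ j := by simpa using hi
    simp only [Finset.mem_range]
    omega
  · intro i _ i' _ h
    exact Fin.ext h
  · intro i hi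
    have hi' : i < j.1 + 1 := by simpa using hi
    have hij : (⟨i, by omega⟩ : Fin n) ≤ j := Fin.le_def.2 (Nat.lt_succ_iff.1 hi')
    exact ⟨⟨i, by omega⟩, by simpa using hij, rfl⟩
  · intro i _
    exact (extendZero_of_lt b i.2).symm

theorem isBallot_iff {n : ℕ} (b : Fin n → ℤ) :
    IsBallot b ↔ (∀ i < n, extendZero b i = 1 ∨ extendZero b i = -1) ∧
      ∀ j ≤ n, 0 ≤ ∑ i ∈ Finset.range j, extendZero b i := by
  unfold IsBallot
  refine and_congr ?_ ?_
  · constructor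
    · intro h i hi
      rw [extendZero_of_lt b hi]
      exact h _
    · intro h i
      simpa [extendZero_of_lt b i.2] using h i i.2
  · simp only [sum_filter_le_eq_sum_range]
    constructor
    · rintro h (_ | j) hj
      · simp
      · exact h ⟨j, hj⟩
    · intro h j
      exact h _ j.2

theorem sum_extendZero_eq {n : ℕ} {b : Fin n → ℤ} (hb : ∀ i, b i = 1 ∨ b i = -1) :
    ∑ i ∈ Finset.range n, extendZero b i = 2 * (ones b : ℤ) - n := by
  have h1 : ∑ i ∈ Finset.range n, extendZero b i = ∑ i : Fin n, b i := by
    rw [Finset.sum_range]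
    exact Finset.sum_congr rfl fun i _ => extendZero_of_lt b i.2
  have h2 : ∀ i, b i = 2 * (if b i = 1 then 1 else 0) - 1 := by
    intro i
    rcases hb i with h | h <;> simp [h]
  have h3 : ∑ i : Fin n, b i = ∑ i : Fin n, (2 * (if b i = 1 then 1 else 0) - 1 : ℤ) :=
    Finset.sum_congr rfl fun i _ => h2 i
  rw [h1, h3, Finset.sum_sub_distrib, ← Finset.mul_sum]
  simp [ones]

theorem eps_eq_zero_iff {n : ℕ} (b : Fin n → ℤ) :
    eps b = 0 ↔ ∀ i, Odd i → i + 1 < n → extendZero b i ≠ -extendZero b (i + 1) := by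
  unfold eps
  rw [Nat.sInf_eq_zero]
  constructor
  · rintro (⟨_, h, _⟩ | h) i hi hin heq
    · omega
    · refine (Set.eq_empty_iff_forall_notMem.1 h) (i + 1) ⟨hi.add_one, by omega, hin, ?_⟩
      rwa [extendZero_of_lt b (by omega), extendZero_of_lt b hin] at heq
  · intro h
    refine Or.inr (Set.eq_empty_iff_forall_notMem.2 ?_)
    rintro d ⟨hd, hd1, hdn, heq⟩
    obtain ⟨i, rfl⟩ : ∃ i, d = i + 1 := ⟨d - 1, by omega⟩
    refine h i (by grind) hdn ?_
    rw [extendZero_of_lt b (by omega), extendZero_of_lt b hdn]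
    exact heq

theorem eps_eq_add_one_iff {n : ℕ} (b : Fin n → ℤ) (p : ℕ) :
    eps b = p + 1 ↔ (Odd p ∧ p + 1 < n ∧ extendZero b p = -extendZero b (p + 1)) ∧
      ∀ i < p, Odd i → i + 1 < n → extendZero b i ≠ -extendZero b (i + 1) := by
  have key : ∀ i, i + 1 ∈ {d : ℕ | Even d ∧ 1 ≤ d ∧ ∃ h : d < n, b ⟨d - 1, by omega⟩ = -b ⟨d, h⟩} ↔
      Odd i ∧ i + 1 < n ∧ extendZero b i = -extendZero b (i + 1) := by
    intro i
    constructor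
    · rintro ⟨hd, hd1, hdn, heq⟩
      refine ⟨by grind, hdn, ?_⟩
      rw [extendZero_of_lt b (by omega), extendZero_of_lt b hdn]
      exact heq
    · rintro ⟨hi, hin, heq⟩
      refine ⟨hi.add_one, by omega, hin, ?_⟩
      rwa [extendZero_of_lt b (by omega), extendZero_of_lt b hin] at heq
  unfold eps
  constructor
  · intro h
    refine ⟨?_, fun i hi ho hin heq => ?_⟩
    · rw [← key, ← h]
      exact Nat.sInf_mem (Nat.nonempty_of_pos_sInf (by omega))
    · have := Nat.sInf_le ((key i).2 ⟨ho, hin, heq⟩)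
      omega
  · rintro ⟨hp, hmin⟩
    have hmem := (key p).2 hp
    refine le_antisymm (Nat.sInf_le hmem) (le_csInf ⟨_, hmem⟩ ?_)
    intro d hd
    by_contra! hlt
    obtain ⟨i, rfl⟩ : ∃ i, d = i + 1 := ⟨d - 1, by have := hd.2.1; omega⟩
    obtain ⟨ho, hin, heq⟩ := (key i).1 hd
    exact hmin i (by omega) ho hin heq

theorem delta_eq_add_one_iff {n : ℕ} (b : Fin n → ℤ) (p : ℕ) :
    delta b = p + 1 ↔ (p + 1 < n ∧ extendZero b p = 1 ∧ extendZero b (p + 1) = -1) ∧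
      ∀ i, p < i → i + 1 < n → extendZero b i = 1 → extendZero b (i + 1) ≠ -1 := by
  have key : ∀ i, i + 1 ∈ {d : ℕ | 1 ≤ d ∧
        ∃ h : d < n, b ⟨d - 1, by omega⟩ = 1 ∧ b ⟨d, h⟩ = -1} ↔
      i + 1 < n ∧ extendZero b i = 1 ∧ extendZero b (i + 1) = -1 := by
    intro i
    constructor
    · rintro ⟨hd1, hdn, heq⟩
      refine ⟨hdn, ?_⟩
      rw [extendZero_of_lt b (by omega), extendZero_of_lt b hdn]
      exact heq
    · rintro ⟨hin, heq⟩
      refine ⟨by omega, hin, ?_⟩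
      rwa [extendZero_of_lt b (by omega), extendZero_of_lt b hin] at heq
  have hbdd : BddAbove {d : ℕ | 1 ≤ d ∧
      ∃ h : d < n, b ⟨d - 1, by omega⟩ = 1 ∧ b ⟨d, h⟩ = -1} :=
    ⟨n, fun d hd => hd.2.1.le⟩
  unfold delta
  constructor
  · intro h
    refine ⟨?_, fun i hi hin h1 h2 => ?_⟩
    · rw [← key, ← h]
      refine Nat.sSup_mem (Set.nonempty_iff_ne_empty.2 fun he => ?_) hbdd
      rw [he, csSup_empty] at h
      simp at h
    · have := le_csSup hbdd ((key i).2 ⟨hin, h1, h2⟩)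
      omega
  · rintro ⟨hp, hmax⟩
    have hmem := (key p).2 hp
    refine le_antisymm (csSup_le ⟨_, hmem⟩ ?_) (le_csSup hbdd hmem)
    intro d hd
    by_contra! hlt
    obtain ⟨i, rfl⟩ : ∃ i, d = i + 1 := ⟨d - 1, by omega⟩
    obtain ⟨hin, h1, h2⟩ := (key i).1 hd
    exact hmax i (by omega) hin h1 h2

/-- The zero-based shape shared by the sequences counted on both sides: equal pairs up to
index `p`, then `c, 1, -1, …, -1, -c, 1, …, 1` from index `p` on, with `-c` at the even index
`s`. The value `c = 1` gives `ε = 0`, and `c = -1` gives `ε = δ - 1`. -/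
structure HasShape (p s : ℕ) (c : ℤ) {n : ℕ} (b : Fin n → ℤ) : Prop where
  le : p + 3 ≤ s
  lt : s < n
  even : Even s
  pair : ∀ i < p, Odd i → extendZero b i = extendZero b (i + 1)
  at_fst : extendZero b p = c
  at_snd : extendZero b (p + 1) = 1
  neg : ∀ i, p + 2 ≤ i → i < s → extendZero b i = -1
  at_flip : extendZero b s = -c
  pos : ∀ i, s < i → i < n → extendZero b i = 1

theorem HasShape.unique {p s s' n : ℕ} {c : ℤ} {b : Fin n → ℤ}
    (h : HasShape p s c b) (h' : HasShape p s' c b) : s = s' := by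
  have aux : ∀ {s s'}, HasShape p s c b → HasShape p s' c b → ¬ s < s' := by
    intro s s' h h' hlt
    have h1 := h.pos s' hlt h'.lt
    have h2 := h'.neg s (by have := h.le; omega) hlt
    have h3 := h.at_flip
    have h4 := h'.at_flip
    omega
  have h1 := aux h h'
  have h2 := aux h' h
  omega

theorem HasShape.flipAt {p s n : ℕ} {c : ℤ} {b : Fin n → ℤ} (hp : Odd p)
    (h : HasShape p s c b) : HasShape p s (-c) (flipAt p s b) := by
  have hle := h.le
  refine ⟨h.le, h.lt, h.even, ?_, ?_, ?_, ?_, ?_, ?_⟩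
  · intro i hi ho
    have : i + 1 ≠ p := by grind
    rw [extendZero_flipAt, extendZero_flipAt, if_neg (by omega), if_neg (by omega)]
    exact h.pair i hi ho
  · rw [extendZero_flipAt, if_pos (by omega), h.at_fst]
  · rw [extendZero_flipAt, if_neg (by omega), h.at_snd]
  · intro i hi his
    rw [extendZero_flipAt, if_neg (by omega), h.neg i hi his]
  · rw [extendZero_flipAt, if_pos (by omega), h.at_flip]
  · intro i hi hin
    rw [extendZero_flipAt, if_neg (by omega), h.pos i hi hin]

theorem sum_range_flipAt {p s n : ℕ} (hps : p < s) (b : Fin n → ℤ) (j : ℕ) :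
    ∑ i ∈ Finset.range j, extendZero (flipAt p s b) i =
      ∑ i ∈ Finset.range j, extendZero b i
        - (if p < j then 2 * extendZero b p else 0) - (if s < j then 2 * extendZero b s else 0) := by
  induction j with
  | zero => simp
  | succ j ih =>
    rw [Finset.sum_range_succ, Finset.sum_range_succ, ih, extendZero_flipAt]
    by_cases h1 : j = p
    · subst h1
      simp [show ¬ s < j by omega, show ¬ s < j + 1 by omega]
      ring
    by_cases h2 : j = s
    · subst h2
      simp [show p < j + 1 by omega, hps]
      ring
    have e1 : (p < j + 1) = (p < j) := by apply propext; omega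
    have e2 : (s < j + 1) = (s < j) := by apply propext; omega
    simp only [h1, h2, e1, e2, or_self, if_false]
    ring

theorem sum_range_of_const {f : ℕ → ℤ} {a j : ℕ} {c : ℤ} (haj : a ≤ j)
    (h : ∀ i, a ≤ i → i < j → f i = c) :
    ∑ i ∈ Finset.range j, f i = ∑ i ∈ Finset.range a, f i + (j - a) * c := by
  induction j, haj using Nat.le_induction with
  | base => simp
  | succ j haj ih =>
    rw [Finset.sum_range_succ, ih fun i h1 h2 => h i h1 (by omega), h j haj (by omega)]
    push_cast
    ring

theorem odd_sum_range {f : ℕ → ℤ} {j : ℕ} (hj : Odd j) (h : ∀ i < j, f i = 1 ∨ f i = -1) :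
    Odd (∑ i ∈ Finset.range j, f i) := by
  have key : ∀ m ≤ j, (∑ i ∈ Finset.range m, f i) % 2 = (m : ℤ) % 2 := by
    intro m hm
    induction m with
    | zero => simp
    | succ m ih =>
      have := ih (by omega)
      rw [Finset.sum_range_succ]
      rcases h m (by omega) with h | h <;> rw [h] <;> push_cast <;> omega
  have := key j le_rfl
  rw [Int.odd_iff, this]
  obtain ⟨r, rfl⟩ := hj
  push_cast
  omega

theorem HasShape.isBallot_flipAt {p s n : ℕ} {c : ℤ} {b : Fin n → ℤ} (hc : c = 1 ∨ c = -1)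
    (hp : Odd p) (h : HasShape p s c b) (hb : IsBallot b) : IsBallot (_root_.flipAt p s b) := by
  have hle := h.le
  have hlt := h.lt
  rw [isBallot_iff] at hb ⊢
  obtain ⟨hv, hs⟩ := hb
  refine ⟨fun i hi => ?_, fun j hj => ?_⟩
  · rw [extendZero_flipAt]
    have := hv i hi
    split_ifs <;> omega
  · rw [sum_range_flipAt (by omega), h.at_fst, h.at_flip]
    have h0 := hs j hj
    by_cases h1 : p < j
    swap
    · rw [if_neg h1, if_neg (by omega)]
      omega
    by_cases h2 : s < j
    · rw [if_pos h1, if_pos h2]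
      omega
    rw [if_pos h1, if_neg h2]
    rcases hc with rfl | rfl
    swap
    · omega
    have hP := hs p (by omega)
    have hPodd := odd_sum_range hp fun i hi => hv i (by omega)
    have hS := hs (s + 1) (by omega)
    have hSodd := odd_sum_range h.even.add_one fun i hi => hv i (by omega)
    rw [Int.odd_iff] at hPodd hSodd
    have e1 := Finset.sum_range_succ (extendZero b) p
    have e2 := Finset.sum_range_succ (extendZero b) (p + 1)
    rw [h.at_fst] at e1
    rw [h.at_snd] at e2
    by_cases h3 : j ≤ p + 2
    · obtain rfl | rfl : j = p + 1 ∨ j = p + 2 := by omega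
      · omega
      · rw [show p + 2 = p + 1 + 1 from rfl]
        omega
    · have e3 := sum_range_of_const (f := extendZero b) (a := j) (j := s) (c := -1) (by omega)
        fun i h1 h2 => h.neg i (by omega) h2
      have e4 := Finset.sum_range_succ (extendZero b) s
      rw [h.at_flip] at e4
      omega

theorem HasShape.ones_flipAt {p s n : ℕ} {c : ℤ} {b : Fin n → ℤ} (hc : c = 1 ∨ c = -1)
    (hp : Odd p) (h : HasShape p s c b) (hb : IsBallot b) :
    ones (_root_.flipAt p s b) = ones b := by
  have hle := h.le
  have hlt := h.lt
  have h1 := sum_extendZero_eq hb.1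
  have h2 := sum_extendZero_eq (h.isBallot_flipAt hc hp hb).1
  rw [sum_range_flipAt (by omega), h.at_fst, h.at_flip, if_pos (by omega), if_pos hlt] at h2
  omega

/-- After its last descent, a `±1` sequence is a block of `-1` followed by a block of `1`. -/
theorem exists_tail {n p : ℕ} {b : Fin n → ℤ}
    (hv : ∀ i < n, extendZero b i = 1 ∨ extendZero b i = -1) (hd : delta b = p + 1) :
    ∃ t, p + 2 ≤ t ∧ t ≤ n ∧ (∀ i, p + 1 ≤ i → i < t → extendZero b i = -1) ∧
      ∀ i, t ≤ i → i < n → extendZero b i = 1 := by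
  obtain ⟨⟨hpn, _, h2⟩, hmax⟩ := (delta_eq_add_one_iff b p).1 hd
  have hex : ∃ t, p + 1 ≤ t ∧ (extendZero b t = 1 ∨ t = n) := ⟨n, by omega, Or.inr rfl⟩
  obtain ⟨hle, hor⟩ := Nat.find_spec hex
  have hmin : ∀ i < Nat.find hex, ¬ _ := fun i hi => Nat.find_min hex hi
  have hlen : Nat.find hex ≤ n := Nat.find_min' hex ⟨by omega, Or.inr rfl⟩
  generalize Nat.find hex = t at *
  refine ⟨t, ?_, hlen, fun i hi hit => ?_, fun i hti => ?_⟩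
  · have : t ≠ p + 1 := by
      rintro rfl
      omega
    omega
  · have h3 := hmin i hit
    have h4 := hv i (by omega)
    tauto
  · induction i, hti using Nat.le_induction with
    | base =>
      intro hi
      exact hor.resolve_right (by omega)
    | succ i hti ih =>
      intro hi
      exact (hv _ hi).resolve_right (hmax i (by omega) hi (ih (by omega)))

theorem HasShape.delta_eq {p s n : ℕ} {c : ℤ} {b : Fin n → ℤ}
    (h : HasShape p s c b) : delta b = p + 2 := by
  have hle := h.le
  have hlt := h.lt
  refine (delta_eq_add_one_iff b (p + 1)).2
    ⟨⟨by omega, h.at_snd, h.neg _ (by omega) (by omega)⟩, fun i hi hin h1 h2 => ?_⟩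
  have h3 := h.at_flip
  rcases lt_trichotomy i s with his | rfl | his
  · have := h.neg i (by omega) his
    omega
  · have := h.pos (i + 1) (by omega) hin
    omega
  · have := h.pos (i + 1) (by omega) hin
    omega

theorem HasShape.eps_eq_zero {p s n : ℕ} {b : Fin n → ℤ} (hp : Odd p) (hb : IsBallot b)
    (h : HasShape p s 1 b) : eps b = 0 := by
  have hle := h.le
  have hlt := h.lt
  have heven := h.even
  rw [isBallot_iff] at hb
  refine (eps_eq_zero_iff b).2 fun i hi hin heq => ?_
  have hv := hb.1 i (by omega)
  rcases lt_trichotomy i p with hip | rfl | hip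
  · have := h.pair i hip hi
    omega
  · have := h.at_fst
    have := h.at_snd
    omega
  · have : i ≠ p + 1 := by grind
    have : i ≠ s := by grind
    rcases lt_or_ge i s with his | his
    · have h1 := h.neg i (by omega) his
      rcases eq_or_ne (i + 1) s with h2 | h2
      · have := h.at_flip
        rw [← h2] at this
        omega
      · have := h.neg (i + 1) (by omega) (by omega)
        omega
    · have := h.pos i (by omega) (by omega)
      have := h.pos (i + 1) (by omega) (by omega)
      omega

theorem HasShape.eps_eq_add_one {p s n : ℕ} {b : Fin n → ℤ} (hp : Odd p) (hb : IsBallot b)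
    (h : HasShape p s (-1) b) : eps b = p + 1 := by
  have hle := h.le
  have hlt := h.lt
  rw [isBallot_iff] at hb
  refine (eps_eq_add_one_iff b p).2
    ⟨⟨hp, by omega, by rw [h.at_fst, h.at_snd]⟩, fun i hip hi hin heq => ?_⟩
  have := h.pair i hip hi
  have hv := hb.1 i (by omega)
  omega

theorem exists_hasShape_one {p n : ℕ} {b : Fin n → ℤ} (hn : Odd n) (hp : Odd p)
    (hb : IsBallot b) (he : eps b = 0) (hd : delta b = p + 2) : ∃ s, HasShape p s 1 b := by
  rw [isBallot_iff] at hb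
  have hv := hb.1
  obtain ⟨⟨hpn, h1, h2⟩, -⟩ := (delta_eq_add_one_iff b (p + 1)).1 hd
  have hpair : ∀ i, Odd i → i + 1 < n → extendZero b i = extendZero b (i + 1) := by
    intro i hi hin
    have := (eps_eq_zero_iff b).1 he i hi hin
    have := hv i (by omega)
    have := hv (i + 1) hin
    omega
  obtain ⟨t, hpt, htn, hneg, hpos⟩ := exists_tail (p := p + 1) hv hd
  have htodd : Odd t := by
    by_contra hcon
    have hlt : t ≠ n := by rintro rfl; exact hcon hn
    obtain ⟨i, rfl⟩ : ∃ i, t = i + 1 := ⟨t - 1, by omega⟩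
    have e1 := hpair i (by grind) (by omega)
    have e2 := hneg i (by omega) (by omega)
    have e3 := hpos (i + 1) le_rfl (by omega)
    omega
  obtain ⟨s, rfl⟩ : ∃ s, t = s + 1 := ⟨t - 1, by omega⟩
  have hs : Even s := by grind
  have hne : s ≠ p + 2 := by grind
  exact ⟨s, by omega, by omega, hs, fun i hi ho => hpair i ho (by omega),
    (hpair p hp (by omega)).trans h1, h1, fun i h3 h4 => hneg i (by omega) (by omega),
    hneg s (by omega) (by omega), fun i h3 h4 => hpos i (by omega) h4⟩

theorem sum_range_odd_mod_four {f : ℕ → ℤ} {m : ℕ} (h0 : f 0 = 1)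
    (hv : ∀ i < 2 * m + 1, f i = 1 ∨ f i = -1)
    (hpair : ∀ i < 2 * m + 1, Odd i → f i = f (i + 1)) :
    (∑ i ∈ Finset.range (2 * m + 1), f i) % 4 = (2 * m + 1) % 4 := by
  induction m with
  | zero => simp [h0]
  | succ m ih =>
    have := ih (fun i hi => hv i (by omega)) fun i hi => hpair i (by omega)
    rw [show 2 * (m + 1) + 1 = 2 * m + 1 + 1 + 1 by ring, Finset.sum_range_succ,
      Finset.sum_range_succ, ← hpair (2 * m + 1) (by omega) ⟨m, rfl⟩]
    rcases hv (2 * m + 1) (by omega) with h | h <;> rw [h] <;> push_cast <;> omega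

theorem exists_hasShape_neg_one {p n : ℕ} {b : Fin n → ℤ} (hn : Odd n) (hk : Odd (ones b))
    (hp : Odd p) (hb : IsBallot b) (he : eps b = p + 1) (hd : delta b = p + 2) :
    ∃ s, HasShape p s (-1) b := by
  have htotal := sum_extendZero_eq hb.1
  rw [isBallot_iff] at hb
  have hv := hb.1
  obtain ⟨⟨hpn, h1, h2⟩, -⟩ := (delta_eq_add_one_iff b (p + 1)).1 hd
  obtain ⟨⟨-, -, hflip⟩, hmin⟩ := (eps_eq_add_one_iff b p).1 he
  have hpair : ∀ i < p, Odd i → extendZero b i = extendZero b (i + 1) := by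
    intro i hip hi
    have := hmin i hip hi (by omega)
    have := hv i (by omega)
    have := hv (i + 1) (by omega)
    omega
  rw [h1] at hflip
  obtain ⟨t, hpt, htn, hneg, hpos⟩ := exists_tail (p := p + 1) hv hd
  have hteven : Even t := by
    obtain ⟨m, rfl⟩ := hp
    have h0 : extendZero b 0 = 1 := by
      have e1 := hb.2 1 (by omega)
      have e2 := hv 0 (by omega)
      simp only [Finset.sum_range_one] at e1
      omega
    have e0 := sum_range_odd_mod_four h0 (fun i hi => hv i (by omega)) hpair
    have e1 := Finset.sum_range_succ (extendZero b) (2 * m + 1)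
    have e2 := Finset.sum_range_succ (extendZero b) (2 * m + 1 + 1)
    have e3 := sum_range_of_const (show 2 * m + 1 + 1 + 1 ≤ t by omega) hneg
    have e4 := sum_range_of_const htn hpos
    rw [hflip] at e1
    rw [h1] at e2
    obtain ⟨r, hr⟩ := hk
    obtain ⟨u, hu⟩ := hn
    rw [Nat.even_iff]
    push_cast at *
    omega
  have hlt : t ≠ n := by grind
  have hne : t ≠ p + 2 := by grind
  exact ⟨t, by omega, by omega, hteven, hpair, hflip, h1, fun i h3 h4 => hneg i (by omega) h4,
    by rw [hpos t le_rfl (by omega)]; rfl, fun i h3 h4 => hpos i (by omega) h4⟩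

/-- A family of involutions matching the pieces of two disjointly decomposed subtypes shows
that the subtypes are equinumerous. -/
theorem card_subtype_eq_of_involutive {α ι : Type*} {P Q : α → Prop} {A B : ι → α → Prop}
    {r : ι → α → α} (hr : ∀ i, Function.Involutive (r i))
    (hP : ∀ a, P a ↔ ∃ i, A i a) (hQ : ∀ a, Q a ↔ ∃ i, B i a)
    (hA : ∀ {i j a}, A i a → A j a → i = j) (hB : ∀ {i j a}, B i a → B j a → i = j)
    (hAB : ∀ {i a}, A i a → B i (r i a)) (hBA : ∀ {i a}, B i a → A i (r i a)) :
    Nat.card {a // P a} = Nat.card {a // Q a} := by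
  choose u hu using fun a : {a // P a} => (hP a).1 a.2
  refine Nat.card_eq_of_bijective
    (fun a => (⟨r (u a) a, (hQ _).2 ⟨_, hAB (hu a)⟩⟩ : {a // Q a})) ⟨fun a a' h => ?_, ?_⟩
  · have h' : r (u a) a = r (u a') a' := congrArg Subtype.val h
    have h1 := hAB (hu a)
    rw [h'] at h1
    rw [hB h1 (hAB (hu a'))] at h'
    exact Subtype.ext ((hr _).injective h')
  · rintro ⟨a, ha⟩
    obtain ⟨i, hi⟩ := (hQ a).1 ha
    refine ⟨⟨r i a, (hP _).2 ⟨i, hBA hi⟩⟩, Subtype.ext ?_⟩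
    have h1 := hA (hu ⟨r i a, (hP _).2 ⟨i, hBA hi⟩⟩) (hBA hi)
    simp only [h1]
    exact hr i a

theorem card_Astar_eq_card_Bstar_odd (n k d : ℕ)
    (hn : Odd n) (hk : Odd k) (hd : Odd d) :
    Nat.card {q : Fin n → ℤ //
        IsBallot q ∧ ones q = k ∧ eps q = 0 ∧ delta q = d}
      =
    Nat.card {q : Fin n → ℤ //
        IsBallot q ∧ ones q = k ∧ eps q = delta q - 1 ∧ delta q = d} := by
  obtain ⟨m, rfl⟩ := hd
  rcases m with _ | m
  · refine Nat.card_congr (Equiv.subtypeEquivRight fun q => ?_)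
    constructor <;> rintro ⟨h1, h2, h3, h4⟩ <;> exact ⟨h1, h2, by omega, h4⟩
  obtain ⟨p, hp, hpd⟩ : ∃ p, Odd p ∧ 2 * (m + 1) + 1 = p + 2 := ⟨2 * m + 1, ⟨m, rfl⟩, by ring⟩
  rw [hpd]
  refine card_subtype_eq_of_involutive (r := fun s => flipAt p s)
    (A := fun s q => IsBallot q ∧ ones q = k ∧ HasShape p s 1 q)
    (B := fun s q => IsBallot q ∧ ones q = k ∧ HasShape p s (-1) q)
    (fun s => flipAt_flipAt p s) (fun q => ?_) (fun q => ?_)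
    (fun h h' => h.2.2.unique h'.2.2)
    (fun h h' => h.2.2.unique h'.2.2) ?_ ?_
  · constructor
    · rintro ⟨hb, hq, he, hd⟩
      obtain ⟨s, hs⟩ := exists_hasShape_one hn hp hb he hd
      exact ⟨s, hb, hq, hs⟩
    · rintro ⟨s, hb, hq, hs⟩
      exact ⟨hb, hq, hs.eps_eq_zero hp hb, hs.delta_eq⟩
  · constructor
    · rintro ⟨hb, hq, he, hd⟩
      obtain ⟨s, hs⟩ := exists_hasShape_neg_one hn (hq ▸ hk) hp hb (by omega) hd
      exact ⟨s, hb, hq, hs⟩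
    · rintro ⟨s, hb, hq, hs⟩
      have hd := hs.delta_eq
      exact ⟨hb, hq, by rw [hs.eps_eq_add_one hp hb, hd]; rfl, hd⟩
  · rintro s q ⟨hb, hq, hs⟩
    exact ⟨hs.isBallot_flipAt (Or.inl rfl) hp hb,
      (hs.ones_flipAt (Or.inl rfl) hp hb).trans hq, hs.flipAt hp⟩
  · rintro s q ⟨hb, hq, hs⟩
    exact ⟨hs.isBallot_flipAt (Or.inr rfl) hp hb,
      (hs.ones_flipAt (Or.inr rfl) hp hb).trans hq, by simpa using hs.flipAt hp⟩
end

section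
/- For every n ≥ 1, the number of even 321-avoiding permutations of {1,…,n} minus the number of odd 321-avoiding permutations of {1,…,n} equals the Catalan number C_{(n−1)/2} if n is odd, and equals 0 if n is even. -/
open scoped Classical


/-- The values of `π` below `q` occur in increasing order. -/
def IncreasingBelow {n : ℕ} (q : ℕ) (π : Equiv.Perm (Fin n)) : Prop :=
  ∀ i j : Fin n, i < j → (π i : ℕ) < q → π i < π j

/-- Prepend the value `p` to `σ`, shifting up the values of `σ` that are at least `p`. -/
def prependValue {n : ℕ} (p : Fin (n + 1)) (σ : Equiv.Perm (Fin n)) : Equiv.Perm (Fin (n + 1)) :=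
  p.cycleRange.symm * Equiv.Perm.decomposeFin.symm (0, σ)

theorem prependValue_zero {n : ℕ} (p : Fin (n + 1)) (σ : Equiv.Perm (Fin n)) :
    prependValue p σ 0 = p := by
  simp [prependValue]

theorem prependValue_succ {n : ℕ} (p : Fin (n + 1)) (σ : Equiv.Perm (Fin n)) (i : Fin n) :
    prependValue p σ i.succ = p.succAbove (σ i) := by
  simp [prependValue]

theorem sign_prependValue {n : ℕ} (p : Fin (n + 1)) (σ : Equiv.Perm (Fin n)) :
    Equiv.Perm.sign (prependValue p σ) = (-1) ^ (p : ℕ) * Equiv.Perm.sign σ := by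
  simp [prependValue]

theorem prependValue_bijective (n : ℕ) :
    Function.Bijective
      (fun x : Fin (n + 1) × Equiv.Perm (Fin n) => prependValue x.1 x.2) := by
  rw [Fintype.bijective_iff_injective_and_card]
  constructor
  · rintro ⟨p, σ⟩ ⟨p', σ'⟩ h
    simp only at h
    have hp : p = p' := by
      rw [← prependValue_zero p σ, h, prependValue_zero]
    subst hp
    have hσ : σ = σ' := by
      ext i : 1
      apply p.succAbove_right_injective
      rw [← prependValue_succ, h, prependValue_succ]
    rw [hσ]
  · exact (Fintype.card_congr Equiv.Perm.decomposeFin).symm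

theorem val_succAbove {n : ℕ} (p : Fin (n + 1)) (i : Fin n) :
    (p.succAbove i : ℕ) = if (i : ℕ) < p then (i : ℕ) else i + 1 := by
  by_cases h : (i : ℕ) < p <;> simp [Fin.succAbove, Fin.lt_def, h]

theorem avoids321_prependValue {n : ℕ} (p : Fin (n + 1)) (σ : Equiv.Perm (Fin n)) :
    Avoids321 (prependValue p σ) ↔ Avoids321 σ ∧ IncreasingBelow p σ := by
  constructor
  · intro h
    refine ⟨?_, ?_⟩
    · rintro ⟨i, j, k, hij, hjk, h1, h2⟩
      refine h ⟨i.succ, j.succ, k.succ, by simpa, by simpa, ?_, ?_⟩ <;>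
        simpa [prependValue_succ]
    · intro i j hij hp
      by_contra hlt
      have hne : σ i ≠ σ j := fun e => hij.ne (σ.injective e)
      refine h ⟨0, i.succ, j.succ, by simp, by simpa, ?_, ?_⟩
      · simpa [prependValue_succ] using lt_of_le_of_ne (not_lt.1 hlt) hne.symm
      · rw [prependValue_zero, prependValue_succ, Fin.lt_def, val_succAbove, if_pos hp]
        exact hp
  · rintro ⟨h, hp⟩ ⟨i, j, k, hij, hjk, h1, h2⟩
    obtain ⟨j, rfl⟩ := Fin.exists_succ_eq.2 (Fin.ne_zero_of_lt hij)
    obtain ⟨k, rfl⟩ := Fin.exists_succ_eq.2 (Fin.ne_zero_of_lt hjk)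
    simp only [prependValue_succ, Fin.succAbove_lt_succAbove_iff, Fin.succ_lt_succ_iff] at h1 hjk
    rcases Fin.eq_zero_or_eq_succ i with rfl | ⟨i, rfl⟩
    · rw [prependValue_zero, prependValue_succ, Fin.lt_def, val_succAbove] at h2
      have := hp j k hjk (by split_ifs at h2 <;> omega)
      exact lt_asymm h1 this
    · simp only [prependValue_succ, Fin.succAbove_lt_succAbove_iff, Fin.succ_lt_succ_iff] at h2 hij
      exact h ⟨i, j, k, hij, hjk, h1, h2⟩

theorem increasingBelow_prependValue_of_le {n q : ℕ} {p : Fin (n + 1)} {σ : Equiv.Perm (Fin n)}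
    (hq : q ≤ p) (h : IncreasingBelow p σ) : IncreasingBelow q (prependValue p σ) := by
  intro i j hij hi
  obtain ⟨j, rfl⟩ := Fin.exists_succ_eq.2 (Fin.ne_zero_of_lt hij)
  rcases Fin.eq_zero_or_eq_succ i with rfl | ⟨i, rfl⟩
  · rw [prependValue_zero] at hi
    omega
  · simp only [prependValue_succ, Fin.succAbove_lt_succAbove_iff, Fin.succ_lt_succ_iff] at hij ⊢
    rw [prependValue_succ, val_succAbove] at hi
    exact h i j hij (by split_ifs at hi <;> omega)

theorem increasingBelow_succ_prependValue_zero {n q : ℕ} (σ : Equiv.Perm (Fin n)) :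
    IncreasingBelow (q + 1) (prependValue 0 σ) ↔ IncreasingBelow q σ := by
  constructor
  · intro h i j hij hi
    simpa [prependValue_succ] using
      h i.succ j.succ (by simpa) (by simpa [prependValue_succ] using hi)
  · intro h i j hij hi
    obtain ⟨j, rfl⟩ := Fin.exists_succ_eq.2 (Fin.ne_zero_of_lt hij)
    rcases Fin.eq_zero_or_eq_succ i with rfl | ⟨i, rfl⟩
    · simp [prependValue_zero, prependValue_succ]
    · simp only [prependValue_succ, Fin.succAbove_zero, Fin.succ_lt_succ_iff, Fin.val_succ]
        at hij hi ⊢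
      exact h i j hij (by omega)

theorem not_increasingBelow_prependValue_succ {n q : ℕ} {p : Fin n} (σ : Equiv.Perm (Fin n))
    (hq : (p : ℕ) + 1 < q) : ¬ IncreasingBelow q (prependValue p.succ σ) := by
  intro h
  have : NeZero n := ⟨by have := p.isLt; omega⟩
  have := h 0 (σ.symm 0).succ (by simp) (by simpa [prependValue_zero])
  simp [prependValue_zero, prependValue_succ] at this

theorem increasingBelow_zero {n : ℕ} (π : Equiv.Perm (Fin n)) : IncreasingBelow 0 π :=
  fun _ _ _ h => absurd h (Nat.not_lt_zero _)

theorem increasingBelow_one {n : ℕ} (π : Equiv.Perm (Fin n)) : IncreasingBelow 1 π := by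
  intro i j hij hi
  have : π i ≠ π j := fun e => hij.ne (π.injective e)
  omega

/-- The signed count of the 321-avoiding permutations whose values below `q` occur in increasing
order. -/
noncomputable def signedCount (n q : ℕ) : ℤ :=
  ∑ π : Equiv.Perm (Fin n),
    if Avoids321 π ∧ IncreasingBelow q π then (Equiv.Perm.sign π : ℤ) else 0

theorem signedCount_zero_right (n : ℕ) : signedCount n 0 = signedCount n 1 := by
  simp [signedCount, increasingBelow_zero, increasingBelow_one]

theorem signedCount_zero_zero : signedCount 0 0 = 1 := by
  have h (π : Equiv.Perm (Fin 0)) : Avoids321 π := fun ⟨i, _⟩ => i.elim0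
  simp [signedCount, increasingBelow_zero, h]

theorem signedCount_succ_succ (n q : ℕ) :
    signedCount (n + 1) (q + 1) =
      signedCount n q + ∑ p ∈ Finset.Ico q n, (-1) ^ (p + 1) * signedCount n (p + 1) := by
  have hsum : ∑ p ∈ Finset.Ico q n, (-1) ^ (p + 1) * signedCount n (p + 1) =
      ∑ p : Fin n, if q ≤ p then (-1) ^ ((p : ℕ) + 1) * signedCount n (p + 1) else 0 := by
    rw [Fin.sum_univ_eq_sum_range
      (fun p => if q ≤ p then (-1) ^ (p + 1) * signedCount n (p + 1) else 0), ← Finset.sum_filter]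
    congr 1
    ext p
    simp [and_comm]
  rw [hsum, signedCount, ← (prependValue_bijective n).sum_comp, Fintype.sum_prod_type,
    Fin.sum_univ_succ]
  congr 1
  · refine Finset.sum_congr rfl fun σ _ => ?_
    simp only [avoids321_prependValue, increasingBelow_succ_prependValue_zero, sign_prependValue]
    simp [increasingBelow_zero]
  · refine Finset.sum_congr rfl fun p _ => ?_
    split_ifs with hq
    · rw [signedCount, Finset.mul_sum]
      refine Finset.sum_congr rfl fun σ _ => ?_
      rw [mul_ite, mul_zero]
      have hiff : (Avoids321 (prependValue p.succ σ) ∧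
          IncreasingBelow (q + 1) (prependValue p.succ σ)) ↔
          Avoids321 σ ∧ IncreasingBelow (p + 1) σ := by
        rw [avoids321_prependValue, Fin.val_succ]
        exact ⟨And.left, fun h =>
          ⟨h, increasingBelow_prependValue_of_le (by simpa) (by simpa using h.2)⟩⟩
      simp only [hiff, sign_prependValue]
      simp
    · refine Finset.sum_eq_zero fun σ _ => if_neg fun h => ?_
      exact not_increasingBelow_prependValue_succ σ (by omega) h.2

theorem signedCount_self (n : ℕ) : signedCount n n = 1 := by
  induction n with
  | zero => exact signedCount_zero_zero
  | succ n ih => simp [signedCount_succ_succ, ih]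

theorem signedCount_succ_succ_eq_add {n q : ℕ} (hq : q < n) :
    signedCount (n + 1) (q + 1) = signedCount (n + 1) (q + 2) + signedCount n q
      - signedCount n (q + 1) + (-1) ^ (q + 1) * signedCount n (q + 1) := by
  rw [signedCount_succ_succ, signedCount_succ_succ n (q + 1), Finset.sum_eq_sum_Ico_succ_bot hq]
  ring

theorem signedCount_succ_even {n j : ℕ} (hj : 2 * j + 1 < n) :
    signedCount (n + 1) (2 * j + 2) =
      signedCount (n + 1) (2 * j + 3) + signedCount n (2 * j + 1) := by
  rw [signedCount_succ_succ_eq_add hj, Even.neg_one_pow ⟨j + 1, by ring⟩]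
  ring

theorem signedCount_succ_odd {n j : ℕ} (hj : 2 * j < n) :
    signedCount (n + 1) (2 * j + 1) = signedCount (n + 1) (2 * j + 2) + signedCount n (2 * j)
      - 2 * signedCount n (2 * j + 1) := by
  rw [signedCount_succ_succ_eq_add hj, Odd.neg_one_pow ⟨j, rfl⟩]
  ring

/-- The number of ballot sequences with `k` votes for and `d` votes against, when `d ≤ k`. -/
def ballotNumber (k d : ℕ) : ℤ := (k + d).choose k - (k + d).choose (k + 1)

theorem ballotNumber_zero_right (k : ℕ) : ballotNumber k 0 = 1 := by
  simp [ballotNumber]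

theorem ballotNumber_self_succ (k : ℕ) : ballotNumber k (k + 1) = 0 := by
  rw [ballotNumber, sub_eq_zero, Nat.choose_symm_add]

theorem ballotNumber_succ_succ (k d : ℕ) :
    ballotNumber (k + 1) (d + 1) = ballotNumber (k + 1) d + ballotNumber k (d + 1) := by
  have h : k + 1 + (d + 1) = (k + d + 1) + 1 := by ring
  have h' : k + 1 + d = k + d + 1 := by ring
  simp only [ballotNumber, h, h', ← add_assoc k d 1, Nat.choose_succ_succ' (k + d + 1)]
  push_cast
  ring

theorem ballotNumber_self (k : ℕ) : ballotNumber k k = catalan k := by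
  have h1 := succ_mul_catalan_eq_centralBinom k
  have h2 := Nat.choose_succ_right_eq (k + k) k
  rw [Nat.add_sub_cancel, ← two_mul, ← Nat.centralBinom_eq_two_mul_choose] at h2
  have h3 : ((k : ℤ) + 1) * ballotNumber k k = (k + 1) * catalan k := by
    rw [ballotNumber, ← two_mul, ← Nat.centralBinom_eq_two_mul_choose]
    zify at h1 h2
    linarith
  exact mul_left_cancel₀ (by positivity) h3

theorem signedCount_even_of_odd {k : ℕ}
    (h : ∀ j d, j + d = k → signedCount (2 * k + 1) (2 * j) = ballotNumber k d ∧
      signedCount (2 * k + 1) (2 * j + 1) = ballotNumber k d) :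
    ∀ d j, j + d = k → signedCount (2 * k + 2) (2 * j + 2) = ballotNumber k d ∧
      signedCount (2 * k + 2) (2 * j + 1) = 0 := by
  have hodd : ∀ d j, j + d = k →
      signedCount (2 * k + 2) (2 * j + 2) = ballotNumber k d →
      signedCount (2 * k + 2) (2 * j + 1) = 0 := by
    intro d j hjd he
    rw [signedCount_succ_odd (by omega), he, (h j d hjd).1, (h j d hjd).2]
    ring
  intro d
  induction d with
  | zero =>
    intro j hj
    have he : signedCount (2 * k + 2) (2 * j + 2) = ballotNumber k 0 := by
      obtain rfl : j = k := hj
      rw [signedCount_self, ballotNumber_zero_right]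
    exact ⟨he, hodd 0 j hj he⟩
  | succ d ih =>
    intro j hj
    have he : signedCount (2 * k + 2) (2 * j + 2) = ballotNumber k (d + 1) := by
      have h0 := (ih (j + 1) (by omega)).2
      rw [signedCount_succ_even (by omega), (h j _ hj).2, show 2 * j + 3 = 2 * (j + 1) + 1 by ring,
        h0, zero_add]
    exact ⟨he, hodd _ j hj he⟩

theorem signedCount_odd (k : ℕ) :
    ∀ j d, j + d = k → signedCount (2 * k + 1) (2 * j) = ballotNumber k d ∧
      signedCount (2 * k + 1) (2 * j + 1) = ballotNumber k d := by
  induction k with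
  | zero =>
    intro j d hjd
    obtain ⟨rfl, rfl⟩ : j = 0 ∧ d = 0 := by omega
    have h := signedCount_self 1
    rw [ballotNumber_zero_right]
    exact ⟨(signedCount_zero_right 1).trans h, h⟩
  | succ k ih =>
    have hk := signedCount_even_of_odd ih
    have heven : ∀ j, j ≤ k + 1 →
        signedCount (2 * (k + 1) + 1) (2 * j) = signedCount (2 * (k + 1) + 1) (2 * j + 1) := by
      intro j hj
      rcases j with _ | j
      · exact signedCount_zero_right _
      · rw [show 2 * (j + 1) = 2 * j + 2 by ring, signedCount_succ_even (by omega),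
          show 2 * (k + 1) = 2 * k + 2 by ring, (hk (k - j) j (by omega)).2, add_zero]
    have hodd : ∀ d j, j + d = k + 1 →
        signedCount (2 * (k + 1) + 1) (2 * j + 1) = ballotNumber (k + 1) d := by
      intro d
      induction d with
      | zero =>
        rintro j rfl
        rw [signedCount_self, ballotNumber_zero_right]
      | succ d ihd =>
        intro j hj
        have h1 : signedCount (2 * (k + 1) + 1) (2 * j + 2) = ballotNumber (k + 1) d :=
          (heven (j + 1) (by omega)).trans (ihd (j + 1) (by omega))
        rw [signedCount_succ_odd (by omega), h1, ballotNumber_succ_succ,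
          show 2 * (k + 1) = 2 * k + 2 by ring, (hk (k - j) j (by omega)).2]
        rcases j with _ | j
        · obtain rfl : d = k := by omega
          have h0 := (hk d 0 (by omega)).2
          rw [ballotNumber_self_succ, mul_zero, signedCount_zero_right, h0]
          ring
        · rw [show 2 * (j + 1) = 2 * j + 2 by ring, (hk (d + 1) j (by omega)).1]
          ring
    exact fun j d hjd => ⟨(heven j (by omega)).trans (hodd d j hjd), hodd d j hjd⟩

theorem card_even_sub_card_odd (n : ℕ) :
    (Nat.card {π : Equiv.Perm (Fin n) // Avoids321 π ∧ Equiv.Perm.sign π = 1} : ℤ) -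
      (Nat.card {π : Equiv.Perm (Fin n) // Avoids321 π ∧ Equiv.Perm.sign π = -1} : ℤ)
      = signedCount n 0 := by
  simp only [Nat.card_eq_fintype_card, Fintype.card_subtype, Finset.card_filter, Nat.cast_sum,
    ← Finset.sum_sub_distrib, signedCount, increasingBelow_zero, and_true]
  refine Finset.sum_congr rfl fun π _ => ?_
  by_cases h : Avoids321 π
  · rcases Int.units_eq_one_or (Equiv.Perm.sign π) with hs | hs <;> simp [h, hs]
  · simp [h]

theorem simion_schmidt_sign_balance (n : ℕ) (hn : 1 ≤ n) :
    (Nat.card {π : Equiv.Perm (Fin n) // Avoids321 π ∧ Equiv.Perm.sign π = 1} : ℤ) -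
      (Nat.card {π : Equiv.Perm (Fin n) // Avoids321 π ∧ Equiv.Perm.sign π = -1} : ℤ)
      = if Odd n then (catalan ((n - 1) / 2) : ℤ) else 0 := by
  rw [card_even_sub_card_odd]
  rcases Nat.even_or_odd' n with ⟨k, rfl | rfl⟩
  · obtain ⟨k, rfl⟩ : ∃ m, k = m + 1 := ⟨k - 1, by omega⟩
    rw [if_neg (by simp), signedCount_zero_right]
    exact (signedCount_even_of_odd (signedCount_odd k) k 0 (by omega)).2
  · rw [if_pos ⟨k, rfl⟩, (signedCount_odd k 0 k (by omega)).1, ballotNumber_self]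
    simp
end

section
/- A permutation π of {1,…,n} is 321-avoiding if and only if π is bi-increasing, i.e., the subsequence of π consisting of its excedance letters (the values π(i) with π(i) > i, taken in order of increasing i) is increasing, and the subsequence consisting of the remaining letters (the values π(i) with π(i) ≤ i, taken in order of increasing i) is also increasing. -/
open scoped Classical


/-- An excedance letter is followed by a smaller letter. -/
theorem Equiv.Perm.exists_gt_apply_lt {n : ℕ} (π : Equiv.Perm (Fin n)) {j : Fin n}
    (hj : j < π j) : ∃ k, j < k ∧ π k < π j := by
  by_contra! h
  have hcard : (Finset.Ioi j).card ≤ (Finset.Ioi (π j)).card := by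
    refine Finset.card_le_card_of_injOn π (fun k hk => ?_) π.injective.injOn
    simp only [Finset.coe_Ioi, Set.mem_Ioi] at hk ⊢
    exact lt_of_le_of_ne (h k hk) (π.injective.ne hk.ne)
  rw [Fin.card_Ioi, Fin.card_Ioi] at hcard
  omega

/-- If the letter at a non-excedance `i` is followed by a smaller letter, then it is preceded
by a larger one. -/
theorem Equiv.Perm.exists_lt_lt_apply {n : ℕ} (π : Equiv.Perm (Fin n)) {i j : Fin n}
    (hi : π i ≤ i) (hij : i < j) (hπ : π j < π i) : ∃ k, k < i ∧ π i < π k := by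
  by_contra! h
  have hcard : (insert j (Finset.Iio i)).card ≤ (Finset.Iio (π i)).card := by
    refine Finset.card_le_card_of_injOn π (fun k hk => ?_) π.injective.injOn
    simp only [Finset.coe_insert, Finset.coe_Iio, Set.mem_insert_iff, Set.mem_Iio] at hk ⊢
    rcases hk with rfl | hk
    · exact hπ
    · exact lt_of_le_of_ne (h k hk) (π.injective.ne hk.ne)
  rw [Finset.card_insert_of_notMem (by simpa using hij.le), Fin.card_Iio, Fin.card_Iio] at hcard
  omega

/-- A permutation is 321-avoiding iff it is bi-increasing: the subsequence of
excedance letters is increasing and the subsequence of the remaining letters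
is increasing. -/
theorem avoids321_iff_biIncreasing (n : ℕ) (π : Equiv.Perm (Fin n)) :
    Avoids321 π ↔
      ((∀ i j : Fin n, i < j → i < π i → j < π j → π i < π j) ∧
       (∀ i j : Fin n, i < j → π i ≤ i → π j ≤ j → π i < π j)) := by
  constructor
  · intro h
    refine ⟨fun i j hij _ hj => ?_, fun i j hij hi _ => ?_⟩
    · by_contra! hle
      obtain ⟨k, hjk, hk⟩ := π.exists_gt_apply_lt hj
      exact h ⟨i, j, k, hij, hjk, hk, lt_of_le_of_ne hle (π.injective.ne hij.ne')⟩
    · by_contra! hle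
      have hlt : π j < π i := lt_of_le_of_ne hle (π.injective.ne hij.ne')
      obtain ⟨k, hki, hk⟩ := π.exists_lt_lt_apply hi hij hlt
      exact h ⟨k, i, j, hki, hij, hlt, hk⟩
  · rintro ⟨hexc, hnon⟩ ⟨i, j, k, hij, hjk, hkj, hji⟩
    rcases lt_or_ge j (π j) with hj | hj
    · exact (hexc i j hij ((hij.trans hj).trans hji) hj).not_gt hji
    · exact (hnon j k hjk hj ((hkj.le.trans hj).trans hjk.le)).not_gt hkj
end
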